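/- Let U be a subfield of ℝ. Suppose A and B are positive square matrices with entries in U which are strong shift equivalent over ℝ₊. Then A and B are strong shift equivalent over U₊ through positive matrices: there is a finite chain of positive square matrices over U from A to B (sizes may vary) in which consecutive matrices are elementary strong shift equivalent over U₊. -/

import Mathlib

open Matrix

/-- All entries of a real matrix lie in the set `S`. -/
def entriesIn {m n : ℕ} (S : Set ℝ) (A : Matrix (Fin m) (Fin n) ℝ) : Prop :=
  ∀ i j, A i j ∈ S

/-- A matrix is positive if every entry is positive. -/
def PosEntries {m n : ℕ} (A : Matrix (Fin m) (Fin n) ℝ) : Prop :=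
  ∀ i j, 0 < A i j

/-- Elementary strong shift equivalence over `S` between square real matrices
(of possibly different sizes). -/
def ESSE (S : Set ℝ) (p q : (n : ℕ) × Matrix (Fin n) (Fin n) ℝ) : Prop :=
  ∃ (R : Matrix (Fin p.1) (Fin q.1) ℝ) (S' : Matrix (Fin q.1) (Fin p.1) ℝ),
    entriesIn S R ∧ entriesIn S S' ∧ p.2 = R * S' ∧ q.2 = S' * R

/-- Strong shift equivalence over `S`: a finite chain of elementary strong shift
equivalences. -/
def SSE (S : Set ℝ) : ((n : ℕ) × Matrix (Fin n) (Fin n) ℝ) →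
    ((n : ℕ) × Matrix (Fin n) (Fin n) ℝ) → Prop :=
  Relation.ReflTransGen (ESSE S)

open Filter Topology

/-- All entries lie in the subfield `U`. -/
def OverField (U : Subfield ℝ) {ι κ : Type*} (M : Matrix ι κ ℝ) : Prop :=
  ∀ i j, M i j ∈ U

/-- All entries are positive. -/
def AllPos {ι κ : Type*} (M : Matrix ι κ ℝ) : Prop :=
  ∀ i j, 0 < M i j

section OverField

variable {U : Subfield ℝ} {ι κ μ : Type*}

lemma OverField.mul [Fintype κ] {M : Matrix ι κ ℝ} {N : Matrix κ μ ℝ}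
    (hM : OverField U M) (hN : OverField U N) : OverField U (M * N) := fun i j => by
  rw [Matrix.mul_apply]
  exact sum_mem fun k _ => mul_mem (hM i k) (hN k j)

lemma OverField.one [DecidableEq ι] : OverField U (1 : Matrix ι ι ℝ) := fun i j => by
  rw [Matrix.one_apply]
  split_ifs
  exacts [one_mem U, zero_mem U]

lemma OverField.det_mem [Fintype ι] [DecidableEq ι] {M : Matrix ι ι ℝ} (hM : OverField U M) :
    M.det ∈ U := by
  rw [Matrix.det_apply]
  refine sum_mem fun σ _ => ?_
  rw [Units.smul_def]
  exact zsmul_mem (prod_mem fun i _ => hM _ _) _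

lemma OverField.inv [Fintype ι] [DecidableEq ι] {M : Matrix ι ι ℝ} (hM : OverField U M) :
    OverField U M⁻¹ := fun i j => by
  rw [Matrix.inv_def, Ring.inverse_eq_inv', Matrix.smul_apply, smul_eq_mul]
  refine mul_mem (inv_mem hM.det_mem) ?_
  rw [Matrix.adjugate_apply]
  refine OverField.det_mem fun a b => ?_
  rw [Matrix.updateRow_apply]
  split_ifs
  · rw [Pi.single_apply]
    split_ifs
    exacts [one_mem U, zero_mem U]
  · exact hM a b

lemma subfield_dense (U : Subfield ℝ) : Dense (U : Set ℝ) := by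
  refine (Rat.denseRange_cast (𝕜 := ℝ)).mono ?_
  rintro _ ⟨q, rfl⟩
  exact SubfieldClass.ratCast_mem U q

lemma dense_overField (U : Subfield ℝ) : Dense {M : Matrix ι κ ℝ | OverField U M} := by
  have h1 : ∀ i : ι, Dense {v : κ → ℝ | ∀ j, v j ∈ U} := fun i => by
    refine (dense_pi Set.univ (s := fun _ : κ => (U : Set ℝ)) fun q _ => subfield_dense U).mono ?_
    exact fun β hβ q => Set.mem_pi.1 hβ q (Set.mem_univ q)
  refine (dense_pi Set.univ (s := fun _ : ι => {v : κ → ℝ | ∀ j, v j ∈ U}) fun i _ => h1 i).mono ?_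
  exact fun M hM i => Set.mem_pi.1 hM i (Set.mem_univ i)

/-- Solutions over `U` of an intertwining system with coefficients in `U` are dense among the
real solutions. -/
lemma mem_closure_intertwiners [Fintype ι] [Fintype κ] {α : Type*}
    (P : α → Matrix κ κ ℝ) (Q : α → Matrix ι ι ℝ) (hP : ∀ a, OverField U (P a))
    (hQ : ∀ a, OverField U (Q a)) (X : Matrix ι κ ℝ) (hX : ∀ a, X * P a = Q a * X) :
    X ∈ closure {Y : Matrix ι κ ℝ | OverField U Y ∧ ∀ a, Y * P a = Q a * Y} := by
  classical
  let V : Submodule U ℝ := Submodule.span U (Set.range fun p : ι × κ => X p.1 p.2)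
  have : FiniteDimensional U V := FiniteDimensional.span_of_finite U (Set.finite_range _)
  let b := Module.finBasis U V
  have hmem : ∀ i j, X i j ∈ V := fun i j => Submodule.subset_span ⟨(i, j), rfl⟩
  let Y : Fin (Module.finrank U V) → Matrix ι κ ℝ :=
    fun q => Matrix.of fun i j => ((b.repr ⟨X i j, hmem i j⟩ q : U) : ℝ)
  have hYU : ∀ q, OverField U (Y q) := fun q i j => SetLike.coe_mem _
  let Φ : (Fin (Module.finrank U V) → ℝ) → Matrix ι κ ℝ := fun β => ∑ q, β q • Y q
  have hΦ : Continuous Φ := by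
    refine continuous_finsetSum _ fun q _ => ?_
    exact (continuous_apply q).smul continuous_const
  let β₀ : Fin (Module.finrank U V) → ℝ := fun q => (b q : ℝ)
  have hβ₀ : LinearIndependent U β₀ :=
    b.linearIndependent.map' V.subtype (Submodule.ker_subtype V)
  have hX₀ : Φ β₀ = X := by
    ext i j
    have h := congrArg (V.subtype) (b.sum_repr ⟨X i j, hmem i j⟩)
    simp only [map_sum, map_smul, Submodule.subtype_apply] at h
    rw [← h]
    simp only [Φ, Matrix.sum_apply, Matrix.smul_apply, Y, Matrix.of_apply, smul_eq_mul, β₀]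
    refine Finset.sum_congr rfl fun q _ => ?_
    rw [Subfield.smul_def, smul_eq_mul, mul_comm]
  have hY : ∀ q a, Y q * P a = Q a * Y q := by
    intro q a
    ext i j
    have h := congrFun (congrFun (hX a) i) j
    rw [← hX₀, ← sub_eq_zero] at h
    simp only [Φ, Matrix.sum_mul, Matrix.mul_sum, Matrix.smul_mul, Matrix.mul_smul,
      Matrix.sum_apply, Matrix.smul_apply, smul_eq_mul] at h
    rw [← Finset.sum_sub_distrib] at h
    have hc : ∀ r, (Y r * P a) i j - (Q a * Y r) i j ∈ U := fun r =>
      sub_mem ((hYU r).mul (hP a) i j) ((hQ a).mul (hYU r) i j)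
    have := Fintype.linearIndependent_iff.1 hβ₀ (fun r => ⟨_, hc r⟩) (by
      rw [← h]
      refine Finset.sum_congr rfl fun r _ => ?_
      rw [Subfield.smul_def, smul_eq_mul]
      ring) q
    exact sub_eq_zero.1 (congrArg Subtype.val this)
  have hdense : Dense {β : Fin (Module.finrank U V) → ℝ | ∀ q, β q ∈ U} := by
    have := dense_pi (Set.univ : Set (Fin (Module.finrank U V)))
      (s := fun _ => (U : Set ℝ)) fun q _ => subfield_dense U
    refine this.mono fun β hβ q => Set.mem_pi.1 hβ q (Set.mem_univ q)
  rw [← hX₀]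
  refine map_mem_closure hΦ (hdense β₀) ?_
  intro β hβ
  refine ⟨fun i j => ?_, fun a => ?_⟩
  · simp only [Φ, Matrix.sum_apply, Matrix.smul_apply, smul_eq_mul]
    exact sum_mem fun q _ => mul_mem (hβ q) (hYU q i j)
  · simp only [Φ, Matrix.sum_mul, Matrix.mul_sum, Matrix.smul_mul, Matrix.mul_smul, hY]

end OverField

section Topology

variable {ι κ : Type*}

lemma isOpen_allPos [Finite ι] [Finite κ] : IsOpen {M : Matrix ι κ ℝ | AllPos M} := by
  have : {M : Matrix ι κ ℝ | AllPos M} = ⋂ i, ⋂ j, {M : Matrix ι κ ℝ | 0 < M i j} := by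
    ext M
    simp [AllPos]
  rw [this]
  refine isOpen_iInter_of_finite fun i => isOpen_iInter_of_finite fun j => ?_
  exact isOpen_lt continuous_const (by fun_prop)

lemma continuousAt_inv_of_det_ne_zero [Fintype ι] [DecidableEq ι] {M : Matrix ι ι ℝ}
    (hM : M.det ≠ 0) : ContinuousAt (fun N : Matrix ι ι ℝ => N⁻¹) M := by
  refine continuousAt_matrix_inv M ?_
  rw [Ring.inverse_eq_inv']
  exact continuousAt_inv₀ hM

lemma eventually_det_ne_zero [Fintype ι] [DecidableEq ι] {M : Matrix ι ι ℝ}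
    (hM : M.det ≠ 0) : ∀ᶠ N in 𝓝 M, N.det ≠ 0 :=
  (show ContinuousAt (fun N : Matrix ι ι ℝ => N.det) M by fun_prop).eventually_ne hM

end Topology

/-- One elementary strong shift equivalence over `U₊` between positive matrices over `U`. -/
def PosStep (U : Subfield ℝ) (p q : (n : ℕ) × Matrix (Fin n) (Fin n) ℝ) : Prop :=
  PosEntries p.2 ∧ PosEntries q.2 ∧
    entriesIn (U : Set ℝ) p.2 ∧ entriesIn (U : Set ℝ) q.2 ∧
    ESSE {x : ℝ | x ∈ U ∧ 0 ≤ x} p q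

/-- The matrix `G` can be reached from `p₀` by a chain of positive steps over `U`, whatever
numbering of its index type is chosen. -/
def Linked (U : Subfield ℝ) (p₀ : (n : ℕ) × Matrix (Fin n) (Fin n) ℝ) {ι : Type} [Fintype ι]
    (G : Matrix ι ι ℝ) : Prop :=
  ∀ n (e : ι ≃ Fin n), Relation.ReflTransGen (PosStep U) p₀ ⟨n, Matrix.reindex e e G⟩

section Linked

variable {U : Subfield ℝ} {p₀ : (n : ℕ) × Matrix (Fin n) (Fin n) ℝ} {ι κ : Type} [Fintype ι]
  [Fintype κ]

lemma AllPos.mul {α β γ : Type*} [Fintype β] {M : Matrix α β ℝ} {N : Matrix β γ ℝ} [Nonempty β]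
    (hM : AllPos M) (hN : AllPos N) : AllPos (M * N) := fun i j => by
  rw [Matrix.mul_apply]
  exact Finset.sum_pos (fun k _ => mul_pos (hM i k) (hN k j)) Finset.univ_nonempty

lemma posStep_reindex {R : Matrix ι κ ℝ} {S : Matrix κ ι ℝ} (hR : OverField U R)
    (hS : OverField U S) (hR0 : ∀ i j, 0 ≤ R i j) (hS0 : ∀ i j, 0 ≤ S i j)
    (h₁ : AllPos (R * S)) (h₂ : AllPos (S * R)) {m n : ℕ} (e : ι ≃ Fin m) (f : κ ≃ Fin n) :
    PosStep U ⟨m, Matrix.reindex e e (R * S)⟩ ⟨n, Matrix.reindex f f (S * R)⟩ := by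
  refine ⟨fun i j => h₁ _ _, fun i j => h₂ _ _, fun i j => hR.mul hS _ _,
    fun i j => hS.mul hR _ _, Matrix.reindex e f R, Matrix.reindex f e S,
    fun i j => ⟨hR _ _, hR0 _ _⟩, fun i j => ⟨hS _ _, hS0 _ _⟩, ?_, ?_⟩
  all_goals simp [Matrix.submatrix_mul_equiv]

lemma Linked.step {R : Matrix ι κ ℝ} {S : Matrix κ ι ℝ} (h : Linked U p₀ (R * S))
    (hR : OverField U R) (hS : OverField U S) (hR0 : ∀ i j, 0 ≤ R i j) (hS0 : ∀ i j, 0 ≤ S i j)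
    (h₁ : AllPos (R * S)) (h₂ : AllPos (S * R)) : Linked U p₀ (S * R) := fun _ f =>
  (h _ (Fintype.equivFin ι)).tail (posStep_reindex hR hS hR0 hS0 h₁ h₂ _ f)

lemma linked_submatrix {m : ℕ} {A : Matrix (Fin m) (Fin m) ℝ} (hA : PosEntries A)
    (hU : entriesIn (U : Set ℝ) A) (σ : ι ≃ Fin m) : Linked U ⟨m, A⟩ (A.submatrix σ σ) := by
  intro n f
  have h := posStep_reindex (U := U) (R := A.submatrix id σ)
    (S := (1 : Matrix (Fin m) (Fin m) ℝ).submatrix σ id) (fun i j => hU _ _)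
    (fun i j => OverField.one _ _) (fun i j => (hA _ _).le)
    (fun i j => by
      rw [Matrix.submatrix_apply, Matrix.one_apply]
      split_ifs <;> norm_num)
    (by rw [Matrix.submatrix_mul_equiv, Matrix.mul_one]; exact fun i j => hA i j)
    (by
      rw [← Matrix.submatrix_mul _ _ σ id σ Function.bijective_id]
      rw [Matrix.one_mul]
      exact fun i j => hA (σ i) (σ j)) (Equiv.refl (Fin m)) f
  rw [Matrix.submatrix_mul_equiv, ← Matrix.submatrix_mul _ _ σ id σ Function.bijective_id] at h
  simp only [Matrix.mul_one, Matrix.one_mul, Matrix.reindex_refl_refl,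
    Matrix.submatrix_id_id] at h
  exact Relation.ReflTransGen.single h

variable [DecidableEq ι]

lemma exists_pos_mem_inv_pos (U : Subfield ℝ) {C : Matrix ι ι ℝ} (hC : AllPos C) :
    ∃ M : Matrix ι ι ℝ, OverField U M ∧ M.det ≠ 0 ∧ AllPos M ∧ AllPos (C * M⁻¹) := by
  let f : ℝ → Matrix ι ι ℝ := fun ε => 1 + ε • Matrix.of fun _ _ => 1
  have hf : Continuous f := by fun_prop
  have hf0 : f 0 = 1 := by simp [f]
  have hdet : ∀ᶠ ε in 𝓝 (0 : ℝ), (f ε).det ≠ 0 :=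
    hf.continuousAt.eventually (eventually_det_ne_zero (by simp [hf0]))
  have hpos : ∀ᶠ ε in 𝓝 (0 : ℝ), AllPos (C * (f ε)⁻¹) := by
    have hinv : ContinuousAt (fun ε => (f ε)⁻¹) 0 :=
      ContinuousAt.comp (g := fun N : Matrix ι ι ℝ => N⁻¹)
        (continuousAt_inv_of_det_ne_zero (by simp [hf0])) hf.continuousAt
    refine (continuousAt_const.mul hinv).eventually (isOpen_allPos.eventually_mem ?_)
    simpa [hf0] using hC
  obtain ⟨δ, hδ, hsub⟩ := mem_nhdsGT_iff_exists_Ioo_subset.1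
    ((hdet.and hpos).filter_mono nhdsWithin_le_nhds : ∀ᶠ ε in 𝓝[>] (0 : ℝ), _)
  obtain ⟨q, hq0, hqδ⟩ := exists_rat_btwn (Set.mem_Ioi.1 hδ)
  obtain ⟨h1, h2⟩ := hsub ⟨hq0, hqδ⟩
  refine ⟨f q, fun i j => ?_, h1, fun i j => ?_, h2⟩
  · simp only [f, Matrix.add_apply, Matrix.smul_apply, Matrix.of_apply, smul_eq_mul, mul_one]
    exact add_mem (OverField.one i j) (SubfieldClass.ratCast_mem U q)
  · simp only [f, Matrix.add_apply, Matrix.smul_apply, Matrix.of_apply, smul_eq_mul, mul_one]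
    have : (0 : ℝ) ≤ (1 : Matrix ι ι ℝ) i j := by
      rw [Matrix.one_apply]; split_ifs <;> norm_num
    exact add_pos_of_nonneg_of_pos this hq0

/-- Conjugating a linked matrix near `C` by a matrix near `1`, all over `U`, keeps it linked. -/
lemma eventually_linked_conj (U : Subfield ℝ) (p₀ : (n : ℕ) × Matrix (Fin n) (Fin n) ℝ)
    {C : Matrix ι ι ℝ} (hC : AllPos C) :
    ∀ᶠ q : Matrix ι ι ℝ × Matrix ι ι ℝ in 𝓝 (1, C), OverField U q.1 → OverField U q.2 →
      Linked U p₀ q.2 → Linked U p₀ (q.1 * q.2 * q.1⁻¹) := by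
  rcases isEmpty_or_nonempty ι with hι | hι
  · refine Eventually.of_forall fun q _ _ h => ?_
    rwa [Subsingleton.elim (q.1 * q.2 * q.1⁻¹) q.2]
  obtain ⟨M, hMU, hMdet, hM, hCM⟩ := exists_pos_mem_inv_pos U hC
  have c1 : ContinuousAt (fun q : Matrix ι ι ℝ × Matrix ι ι ℝ => q.1) (1, C) := continuousAt_fst
  have c2 : ContinuousAt (fun q : Matrix ι ι ℝ × Matrix ι ι ℝ => q.2) (1, C) := continuousAt_snd
  have c1i : ContinuousAt (fun q : Matrix ι ι ℝ × Matrix ι ι ℝ => q.1⁻¹) (1, C) :=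
    ContinuousAt.comp (g := fun N : Matrix ι ι ℝ => N⁻¹)
      (continuousAt_inv_of_det_ne_zero (by simp)) c1
  have cM : ContinuousAt (fun _ : Matrix ι ι ℝ × Matrix ι ι ℝ => M) (1, C) := continuousAt_const
  have cMi : ContinuousAt (fun _ : Matrix ι ι ℝ × Matrix ι ι ℝ => M⁻¹) (1, C) :=
    continuousAt_const
  have key : ∀ {F : Matrix ι ι ℝ × Matrix ι ι ℝ → Matrix ι ι ℝ}, ContinuousAt F (1, C) →
      AllPos (F (1, C)) → ∀ᶠ q in 𝓝 (1, C), AllPos (F q) := fun hF h =>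
    hF.eventually (isOpen_allPos.eventually_mem h)
  have e1 := c1.eventually (eventually_det_ne_zero (M := (1 : Matrix ι ι ℝ)) (by simp))
  have e2 := key c2 hC
  have e3 := key ((c1.mul c2).mul c1i) (by simpa using hC)
  have e4 := key (cM.mul c1) (by simpa using hM)
  have e5 := key (c2.mul (c1i.mul cMi)) (by simpa using hCM)
  have e6 := key (((c1.mul c2).mul c1i).mul cMi) (by simpa using hCM)
  filter_upwards [e1, e2, e3, e4, e5, e6] with ⟨X, G⟩ h1 h2 h3 h4 h5 h6 hX hG hL
  simp only at h1 h2 h3 h4 h5 h6 hX hG hL ⊢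
  have hXi : X⁻¹ * X = 1 := Matrix.nonsing_inv_mul _ (isUnit_iff_ne_zero.2 h1)
  have hMi : M⁻¹ * M = 1 := Matrix.nonsing_inv_mul _ (isUnit_iff_ne_zero.2 hMdet)
  have q1 : G * (X⁻¹ * M⁻¹) * (M * X) = G := by
    rw [Matrix.mul_assoc, Matrix.mul_assoc, ← Matrix.mul_assoc M⁻¹, hMi, Matrix.one_mul, hXi,
      Matrix.mul_one]
  have q2 : X * G * X⁻¹ * M⁻¹ * M = X * G * X⁻¹ := by
    rw [Matrix.mul_assoc, hMi, Matrix.mul_one]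
  have q3 : M * X * (G * (X⁻¹ * M⁻¹)) = M * (X * G * X⁻¹ * M⁻¹) := by
    simp only [Matrix.mul_assoc]
  have l1 : Linked U p₀ (M * X * (G * (X⁻¹ * M⁻¹))) := by
    refine Linked.step (R := G * (X⁻¹ * M⁻¹)) (S := M * X) (by rwa [q1])
      (hG.mul (hX.inv.mul hMU.inv)) (hMU.mul hX) (fun i j => (h5 i j).le) (fun i j => (h4 i j).le)
      (by rwa [q1]) (h4.mul h5)
  rw [q3] at l1
  have l2 := l1.step (hMU) (((hX.mul hG).mul hX.inv).mul hMU.inv) (fun i j => (hM i j).le)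
    (fun i j => (h6 i j).le) (hM.mul h6) (by rwa [q2])
  rwa [q2] at l2

/-- The `U`-rational conjugates of `C` by matrices close to `1` are linked to `p₀`. -/
def Reach (U : Subfield ℝ) (p₀ : (n : ℕ) × Matrix (Fin n) (Fin n) ℝ) (C : Matrix ι ι ℝ) : Prop :=
  ∀ᶠ W in 𝓝 (1 : Matrix ι ι ℝ), OverField U (W * C * W⁻¹) → Linked U p₀ (W * C * W⁻¹)

lemma eventually_eventually_linked (U : Subfield ℝ)
    (p₀ : (n : ℕ) × Matrix (Fin n) (Fin n) ℝ) {C : Matrix ι ι ℝ} (hC : AllPos C) :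
    ∀ᶠ W in 𝓝 (1 : Matrix ι ι ℝ), ∀ᶠ W' in 𝓝 (1 : Matrix ι ι ℝ), OverField U (W * C * W⁻¹) →
      OverField U (W' * C * W'⁻¹) → Linked U p₀ (W * C * W⁻¹) → Linked U p₀ (W' * C * W'⁻¹) := by
  refine Eventually.curry_nhds (p := fun q : Matrix ι ι ℝ × Matrix ι ι ℝ =>
    OverField U (q.1 * C * q.1⁻¹) → OverField U (q.2 * C * q.2⁻¹) →
    Linked U p₀ (q.1 * C * q.1⁻¹) → Linked U p₀ (q.2 * C * q.2⁻¹)) ?_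
  have c1 : ContinuousAt (fun q : Matrix ι ι ℝ × Matrix ι ι ℝ => q.1) (1, 1) := continuousAt_fst
  have c2 : ContinuousAt (fun q : Matrix ι ι ℝ × Matrix ι ι ℝ => q.2) (1, 1) := continuousAt_snd
  have c1i : ContinuousAt (fun q : Matrix ι ι ℝ × Matrix ι ι ℝ => q.1⁻¹) (1, 1) :=
    ContinuousAt.comp (g := fun N : Matrix ι ι ℝ => N⁻¹)
      (continuousAt_inv_of_det_ne_zero (by simp)) c1
  have cC : ContinuousAt (fun _ : Matrix ι ι ℝ × Matrix ι ι ℝ => C) (1, 1) := continuousAt_const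
  have cF : ContinuousAt (fun q : Matrix ι ι ℝ × Matrix ι ι ℝ => (q.2 * q.1⁻¹, q.1 * C * q.1⁻¹))
      (1, 1) := (c2.mul c1i).prodMk ((c1.mul cC).mul c1i)
  have h0 := (eventually_linked_conj U p₀ hC).and
    (continuousAt_fst.eventually (eventually_det_ne_zero (M := (1 : Matrix ι ι ℝ)) (by simp)))
  have h1 := cF.eventually (p := fun q => ∀ᶠ r in 𝓝 q, (OverField U r.1 → OverField U r.2 →
      Linked U p₀ r.2 → Linked U p₀ (r.1 * r.2 * r.1⁻¹)) ∧ r.1.det ≠ 0) (by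
        simpa using h0.eventually_nhds)
  have d1 := c1.eventually (eventually_det_ne_zero (M := (1 : Matrix ι ι ℝ)) (by simp))
  have d2 := c2.eventually (eventually_det_ne_zero (M := (1 : Matrix ι ι ℝ)) (by simp))
  filter_upwards [h1, d1, d2] with ⟨W, W'⟩ h hW hW' hG hG' hL
  simp only at h hW hW' hG hG' hL ⊢
  have hWi : W⁻¹ * W = 1 := Matrix.nonsing_inv_mul _ (isUnit_iff_ne_zero.2 hW)
  have hWi' : W'⁻¹ * W' = 1 := Matrix.nonsing_inv_mul _ (isUnit_iff_ne_zero.2 hW')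
  have hcl := mem_closure_intertwiners (U := U) (fun _ : Unit => W * C * W⁻¹)
    (fun _ : Unit => W' * C * W'⁻¹) (fun _ => hG) (fun _ => hG') (W' * W⁻¹) (fun _ => by
      calc W' * W⁻¹ * (W * C * W⁻¹) = W' * (W⁻¹ * W) * C * W⁻¹ := by simp only [Matrix.mul_assoc]
        _ = W' * C * (W'⁻¹ * W') * W⁻¹ := by rw [hWi, hWi', Matrix.mul_one, Matrix.mul_one]
        _ = W' * C * W'⁻¹ * (W' * W⁻¹) := by simp only [Matrix.mul_assoc])
  have hY := ((Continuous.prodMk_left (W * C * W⁻¹)).continuousAt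
    (x := W' * W⁻¹)).eventually h
  obtain ⟨Y, ⟨hYU, hYG⟩, hYL, hYd⟩ := ((mem_closure_iff_frequently.1 hcl).and_eventually hY).exists
  have hYi : Y * Y⁻¹ = 1 := Matrix.mul_nonsing_inv _ (isUnit_iff_ne_zero.2 hYd)
  have := hYL hYU hG hL
  simp only at this
  rwa [hYG (), Matrix.mul_assoc, hYi, Matrix.mul_one] at this

lemma reach_of_frequently {C : Matrix ι ι ℝ} (hC : AllPos C)
    (h : ∃ᶠ W in 𝓝 (1 : Matrix ι ι ℝ), OverField U (W * C * W⁻¹) ∧ Linked U p₀ (W * C * W⁻¹)) :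
    Reach U p₀ C := by
  obtain ⟨W, ⟨hW, hL⟩, hW'⟩ := (h.and_eventually (eventually_eventually_linked U p₀ hC)).exists
  exact hW'.mono fun W' h' hU => h' hW hU hL

lemma Linked.reach {C : Matrix ι ι ℝ} (hL : Linked U p₀ C) (hC : AllPos C)
    (hU : OverField U C) : Reach U p₀ C := by
  have := (eventually_eventually_linked U p₀ hC).self_of_nhds
  simp only [Matrix.one_mul, inv_one, Matrix.mul_one] at this
  exact this.mono fun W h h' => h hU h' hL

lemma Reach.linked {C : Matrix ι ι ℝ} (h : Reach U p₀ C) (hU : OverField U C) :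
    Linked U p₀ C := by
  have := h.self_of_nhds
  simp only [Matrix.one_mul, inv_one, Matrix.mul_one] at this
  exact this hU

lemma frequently_overField_conj {C W V : Matrix ι ι ℝ} (hW : W.det ≠ 0)
    (hU : OverField U (W * C * W⁻¹)) :
    ∃ᶠ Z in 𝓝 V, OverField U (Z * C * Z⁻¹) := by
  have hWi : W⁻¹ * W = 1 := Matrix.nonsing_inv_mul _ (isUnit_iff_ne_zero.2 hW)
  have h := mem_closure_iff_frequently.1 (dense_overField U (V * W⁻¹))
  have hc : Tendsto (fun Y : Matrix ι ι ℝ => Y * W) (𝓝 (V * W⁻¹)) (𝓝 V) := by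
    have : Continuous (fun Y : Matrix ι ι ℝ => Y * W) := by fun_prop
    have h2 := this.tendsto (V * W⁻¹)
    rwa [Matrix.mul_assoc, hWi, Matrix.mul_one] at h2
  refine hc.frequently (h.mono fun Y hY => ?_)
  rw [Matrix.mul_inv_rev]
  have := (OverField.mul hY hU).mul hY.inv
  simpa only [Matrix.mul_assoc] using this

lemma eventually_reach_conj_iff {C : Matrix ι ι ℝ} (hC : AllPos C) :
    ∀ᶠ V in 𝓝 (1 : Matrix ι ι ℝ), (Reach U p₀ (V * C * V⁻¹) ↔ Reach U p₀ C) := by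
  have shift : ∀ (P : Matrix ι ι ℝ → Prop) (V : Matrix ι ι ℝ),
      (∀ᶠ W in 𝓝 V, P (W * C * W⁻¹)) →
      ∀ᶠ W in 𝓝 (1 : Matrix ι ι ℝ), P (W * (V * C * V⁻¹) * W⁻¹) := fun P V h => by
    have hc : Tendsto (fun Y : Matrix ι ι ℝ => Y * V) (𝓝 1) (𝓝 V) := by
      have : Continuous (fun Y : Matrix ι ι ℝ => Y * V) := by fun_prop
      simpa using this.tendsto 1
    refine (hc.eventually h).mono fun W hW => ?_
    rw [Matrix.mul_inv_rev] at hW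
    simpa only [Matrix.mul_assoc] using hW
  by_cases hR : Reach U p₀ C
  · have := hR.eventually_nhds
    exact this.mono fun V hV => iff_of_true
      (shift (fun M => OverField U M → Linked U p₀ M) V hV) hR
  · have hnot : ∀ᶠ W in 𝓝 (1 : Matrix ι ι ℝ), OverField U (W * C * W⁻¹) →
        ¬ Linked U p₀ (W * C * W⁻¹) := by
      have := mt (reach_of_frequently hC) hR
      rw [not_frequently] at this
      exact this.mono fun W hW h1 h2 => hW ⟨h1, h2⟩
    have hex : ∃ᶠ W in 𝓝 (1 : Matrix ι ι ℝ), OverField U (W * C * W⁻¹) := by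
      have : ∃ᶠ W in 𝓝 (1 : Matrix ι ι ℝ), _ := not_eventually.1 hR
      exact this.mono fun W hW => (Classical.not_imp.1 hW).1
    obtain ⟨W₀, hU₀, hd₀⟩ := (hex.and_eventually
      (eventually_det_ne_zero (M := (1 : Matrix ι ι ℝ)) (by simp))).exists
    filter_upwards [hnot.eventually_nhds, eventually_det_ne_zero (M := (1 : Matrix ι ι ℝ))
      (by simp)] with V hV hVd
    refine iff_of_false (fun hRV => ?_) hR
    have hVi : V⁻¹ * V = 1 := Matrix.nonsing_inv_mul _ (isUnit_iff_ne_zero.2 hVd)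
    have hW0 : (W₀ * V⁻¹).det ≠ 0 := by
      rw [Matrix.det_mul]
      exact mul_ne_zero hd₀ (by
        rw [Matrix.det_nonsing_inv, Ring.inverse_eq_inv']
        exact inv_ne_zero hVd)
    have hfreq := frequently_overField_conj (U := U) (C := V * C * V⁻¹) (V := 1) hW0 (by
      have e : W₀ * V⁻¹ * (V * C * V⁻¹) * (W₀ * V⁻¹)⁻¹ = W₀ * C * W₀⁻¹ := by
        rw [Matrix.mul_inv_rev, Matrix.nonsing_inv_nonsing_inv _ (isUnit_iff_ne_zero.2 hVd)]
        calc W₀ * V⁻¹ * (V * C * V⁻¹) * (V * W₀⁻¹)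
            = W₀ * (V⁻¹ * V) * C * (V⁻¹ * V) * W₀⁻¹ := by simp only [Matrix.mul_assoc]
          _ = W₀ * C * W₀⁻¹ := by rw [hVi, Matrix.mul_one, Matrix.mul_one]
      rwa [e])
    have hno := shift (fun M => OverField U M → ¬ Linked U p₀ M) V hV
    obtain ⟨W, h1, h2, h3⟩ := (hfreq.and_eventually (hno.and hRV)).exists
    exact h2 h1 (h3 h1)

/-- Reachability is constant along a path of positive conjugates. -/
lemma Reach.of_path {C : Matrix ι ι ℝ} (Z : unitInterval → Matrix ι ι ℝ) (hZ : Continuous Z)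
    (hdet : ∀ s, (Z s).det ≠ 0) (hpos : ∀ s, AllPos (Z s * C * (Z s)⁻¹)) {s t : unitInterval}
    (h : Reach U p₀ (Z s * C * (Z s)⁻¹)) : Reach U p₀ (Z t * C * (Z t)⁻¹) := by
  have hloc : IsLocallyConstant fun s => Reach U p₀ (Z s * C * (Z s)⁻¹) := by
    rw [IsLocallyConstant.iff_eventually_eq]
    intro s
    have hZi : (Z s)⁻¹ * Z s = 1 := Matrix.nonsing_inv_mul _ (isUnit_iff_ne_zero.2 (hdet s))
    have hc : Tendsto (fun r => Z r * (Z s)⁻¹) (𝓝 s) (𝓝 1) := by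
      have : Continuous fun r => Z r * (Z s)⁻¹ := by fun_prop
      have h := this.tendsto s
      rwa [Matrix.mul_nonsing_inv _ (isUnit_iff_ne_zero.2 (hdet s))] at h
    refine (hc.eventually (eventually_reach_conj_iff (U := U) (p₀ := p₀) (hpos s))).mono
      fun r hr => propext ?_
    have e : Z r * (Z s)⁻¹ * (Z s * C * (Z s)⁻¹) * (Z r * (Z s)⁻¹)⁻¹ = Z r * C * (Z r)⁻¹ := by
      rw [Matrix.mul_inv_rev, Matrix.nonsing_inv_nonsing_inv _ (isUnit_iff_ne_zero.2 (hdet s))]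
      calc Z r * (Z s)⁻¹ * (Z s * C * (Z s)⁻¹) * (Z s * (Z r)⁻¹)
          = Z r * ((Z s)⁻¹ * Z s) * C * ((Z s)⁻¹ * Z s) * (Z r)⁻¹ := by
            simp only [Matrix.mul_assoc]
        _ = Z r * C * (Z r)⁻¹ := by rw [hZi, Matrix.mul_one, Matrix.mul_one]
    rwa [e] at hr
  exact (hloc.apply_eq_of_preconnectedSpace s t) ▸ h

end Linked

/-- `C` is the direct sum of a nilpotent part and of an invertible part which is similar to a
matrix over `U`. -/
def FieldType (U : Subfield ℝ) {ι : Type*} [Fintype ι] [DecidableEq ι] (C : Matrix ι ι ℝ) : Prop :=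
  ∃ (d : ℕ) (D : Matrix (Fin d) (Fin d) ℝ) (X : Matrix ι (Fin d) ℝ) (Y : Matrix (Fin d) ι ℝ)
    (p : ℕ), OverField U D ∧ IsUnit D.det ∧ C * X = X * D ∧ Y * C = D * Y ∧ Y * X = 1 ∧
    C ^ p = X * D ^ p * Y

section FieldType

variable {U : Subfield ℝ} {ι κ : Type} [Fintype ι] [Fintype κ] [DecidableEq ι] [DecidableEq κ]

/-- The Fitting decomposition of a matrix over a field. -/
lemma exists_fitting {K : Type*} [Field K] (C : Matrix ι ι K) :
    ∃ (d : ℕ) (D : Matrix (Fin d) (Fin d) K) (X : Matrix ι (Fin d) K) (Y : Matrix (Fin d) ι K)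
      (p : ℕ), IsUnit D.det ∧ C * X = X * D ∧ Y * C = D * Y ∧ Y * X = 1 ∧
      C ^ p = X * D ^ p * Y := by
  obtain ⟨p, hcompl, hp⟩ := ((LinearMap.eventually_isCompl_ker_pow_range_pow
    (Matrix.toLin' C)).and (eventually_ge_atTop 1)).exists
  let F := LinearMap.range (Matrix.toLin' C ^ p)
  let b := Module.finBasis K F
  have hpow : ∀ (n : ℕ) (v : ι → K), (Matrix.toLin' C ^ n) v = (C ^ n) *ᵥ v := fun n v => by
    rw [← Matrix.toLin'_pow, Matrix.toLin'_apply]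
  have hF : ∀ v, (C ^ p) *ᵥ v ∈ F := fun v => ⟨v, hpow p v⟩
  have hCF : ∀ v ∈ F, C *ᵥ v ∈ F := by
    rintro _ ⟨w, rfl⟩
    rw [hpow, Matrix.mulVec_mulVec, ← pow_succ', pow_succ, ← Matrix.mulVec_mulVec]
    exact hF _
  let X : Matrix ι (Fin (Module.finrank K F)) K := Matrix.of fun i j => (b j : ι → K) i
  have hXv : ∀ c, X *ᵥ c = ((∑ j, c j • b j : F) : ι → K) := fun c => by
    ext i
    simp [X, Matrix.mulVec, dotProduct, Finset.sum_apply, mul_comm]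
  have hXinj : ∀ c, X *ᵥ c = 0 → c = 0 := fun c hc => by
    rw [hXv] at hc
    have := Fintype.linearIndependent_iff.1 b.linearIndependent c (Subtype.ext hc)
    exact funext this
  have hXcancel : ∀ {α : Type} (P Q : Matrix (Fin (Module.finrank K F)) α K),
      X * P = X * Q → P = Q := fun P Q h => by
    ext i j
    have h1 : X *ᵥ (fun i => P i j - Q i j) = 0 := by
      have : (fun i => P i j - Q i j) = (fun i => P i j) - (fun i => Q i j) := rfl
      rw [this, Matrix.mulVec_sub, sub_eq_zero]
      ext a
      exact congrFun (congrFun h a) j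
    exact sub_eq_zero.1 (congrFun (hXinj _ h1) i)
  have hfac : ∀ {α : Type} (P : Matrix ι α K), (∀ j, (fun i => P i j) ∈ F) →
      ∃ Q : Matrix (Fin (Module.finrank K F)) α K, P = X * Q := fun P hP => by
    refine ⟨Matrix.of fun i j => b.repr ⟨_, hP j⟩ i, ?_⟩
    ext i j
    have := congrFun (hXv (b.repr ⟨_, hP j⟩)) i
    rw [b.sum_repr] at this
    exact this.symm
  obtain ⟨D, hD⟩ := hfac (C * X) fun j => hCF _ (b j).2
  obtain ⟨Y, hY⟩ := hfac (C ^ p) fun j => by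
    have := hF (Pi.single j 1)
    rwa [Matrix.mulVec_single_one] at this
  have hDdet : IsUnit D.det := by
    rw [← Matrix.isUnit_iff_isUnit_det, ← Matrix.mulVec_injective_iff_isUnit,
      ← Matrix.coe_mulVecLin, ← LinearMap.ker_eq_bot, LinearMap.ker_eq_bot']
    intro c hc
    rw [Matrix.mulVecLin_apply] at hc
    refine hXinj c ?_
    have h1 : X *ᵥ c ∈ F := by rw [hXv]; exact SetLike.coe_mem _
    have h2 : X *ᵥ c ∈ LinearMap.ker (Matrix.toLin' C ^ p) := by
      rw [LinearMap.mem_ker, hpow]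
      obtain ⟨q, rfl⟩ : ∃ q, p = q + 1 := ⟨p - 1, by omega⟩
      rw [pow_succ, ← Matrix.mulVec_mulVec, Matrix.mulVec_mulVec c C X, hD,
        ← Matrix.mulVec_mulVec, hc, Matrix.mulVec_zero, Matrix.mulVec_zero]
    exact (Submodule.disjoint_def.1 hcompl.disjoint) _ h2 h1
  have hpowX : ∀ n : ℕ, C ^ n * X = X * D ^ n := fun n => by
    induction n with
    | zero => simp
    | succ n ih => rw [pow_succ, Matrix.mul_assoc, hD, ← Matrix.mul_assoc, ih, Matrix.mul_assoc,
        ← pow_succ]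
  have hYC : Y * C = D * Y := hXcancel _ _ (by
    rw [← Matrix.mul_assoc, ← hY, ← Matrix.mul_assoc, ← hD, Matrix.mul_assoc, ← hY, ← pow_succ,
      ← pow_succ'])
  have hYX : Y * X = D ^ p := hXcancel _ _ (by
    rw [← Matrix.mul_assoc, ← hY, hpowX])
  have hDp : IsUnit (D ^ p).det := by
    rw [Matrix.det_pow]
    exact hDdet.pow p
  refine ⟨_, D, X, (D ^ p)⁻¹ * Y, p, hDdet, hD, ?_, ?_, ?_⟩
  · have hcomm : (D ^ p)⁻¹ * D = D * (D ^ p)⁻¹ := by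
      have h3 : D * D ^ p = D ^ p * D := by rw [← pow_succ, ← pow_succ']
      calc (D ^ p)⁻¹ * D = (D ^ p)⁻¹ * (D * D ^ p) * (D ^ p)⁻¹ := by
            rw [Matrix.mul_assoc, Matrix.mul_assoc, Matrix.mul_nonsing_inv _ hDp, Matrix.mul_one]
        _ = D * (D ^ p)⁻¹ := by
            rw [h3, ← Matrix.mul_assoc, Matrix.nonsing_inv_mul _ hDp, Matrix.one_mul]
    rw [Matrix.mul_assoc, hYC, ← Matrix.mul_assoc, hcomm, Matrix.mul_assoc]
  · rw [Matrix.mul_assoc, hYX, Matrix.nonsing_inv_mul _ hDp]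
  · rw [Matrix.mul_assoc, ← Matrix.mul_assoc _ _ Y, Matrix.mul_nonsing_inv _ hDp, Matrix.one_mul,
      ← hY]

lemma OverField.fieldType {C : Matrix ι ι ℝ} (hC : OverField U C) : FieldType U C := by
  let C' : Matrix ι ι U := Matrix.of fun i j => ⟨C i j, hC i j⟩
  obtain ⟨d, D, X, Y, p, h1, h2, h3, h4, h5⟩ := exists_fitting C'
  have hC' : C'.map U.subtype = C := rfl
  refine ⟨d, D.map U.subtype, X.map U.subtype, Y.map U.subtype, p, fun i j => (D i j).2,
    ?_, ?_, ?_, ?_, ?_⟩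
  · have := h1.map U.subtype
    rwa [RingHom.map_det] at this
  · rw [← hC', ← Matrix.map_mul, h2, Matrix.map_mul]
  · rw [← hC', ← Matrix.map_mul, h3, Matrix.map_mul]
  · rw [← Matrix.map_mul, h4, Matrix.map_one _ (map_zero _) (map_one _)]
  · have hp : ∀ {n : ℕ} (M : Matrix (Fin n) (Fin n) U),
        (M ^ p).map U.subtype = (M.map U.subtype) ^ p := fun M =>
      map_pow (RingHom.mapMatrix U.subtype) M p
    have := congrArg (fun M : Matrix ι ι U => M.map U.subtype) h5
    simp only [Matrix.map_mul] at this
    rw [hp] at this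
    rw [← this]
    exact (map_pow (RingHom.mapMatrix U.subtype) C' p).symm

lemma mul_pow_comm_mul (R : Matrix ι κ ℝ) (S : Matrix κ ι ℝ) (p : ℕ) :
    (S * R) ^ (p + 1) = S * (R * S) ^ p * R := by
  induction p with
  | zero => simp
  | succ p ih =>
    rw [pow_succ, ih, pow_succ (R * S)]
    simp only [Matrix.mul_assoc]

lemma FieldType.swap {R : Matrix ι κ ℝ} {S : Matrix κ ι ℝ} (h : FieldType U (R * S)) :
    FieldType U (S * R) := by
  obtain ⟨d, D, X, Y, p, h0, h1, h2, h3, h4, h5⟩ := h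
  refine ⟨d, D, S * X, D⁻¹ * Y * R, p + 1, h0, h1, ?_, ?_, ?_, ?_⟩
  · rw [Matrix.mul_assoc, ← Matrix.mul_assoc R, h2, Matrix.mul_assoc]
  · calc D⁻¹ * Y * R * (S * R) = D⁻¹ * (Y * (R * S)) * R := by simp only [Matrix.mul_assoc]
      _ = D * (D⁻¹ * Y * R) := by
        rw [h3, ← Matrix.mul_assoc, Matrix.nonsing_inv_mul _ h1, ← Matrix.mul_assoc,
          ← Matrix.mul_assoc, Matrix.mul_nonsing_inv _ h1]
  · calc D⁻¹ * Y * R * (S * X) = D⁻¹ * (Y * (R * S * X)) := by simp only [Matrix.mul_assoc]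
      _ = 1 := by
        rw [h2, ← Matrix.mul_assoc Y, h4, Matrix.one_mul, Matrix.nonsing_inv_mul _ h1]
  · rw [mul_pow_comm_mul, h5, pow_succ]
    have hY : Y = D * (D⁻¹ * Y) := by
      rw [← Matrix.mul_assoc, Matrix.mul_nonsing_inv _ h1, Matrix.one_mul]
    calc S * (X * D ^ p * Y) * R = S * (X * D ^ p * (D * (D⁻¹ * Y))) * R := by rw [← hY]
      _ = S * X * (D ^ p * D) * (D⁻¹ * Y * R) := by simp only [Matrix.mul_assoc]

lemma FieldType.conj {C : Matrix ι ι ℝ} (h : FieldType U C) {W : Matrix ι ι ℝ}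
    (hW : W.det ≠ 0) : FieldType U (W * C * W⁻¹) := by
  have e : W⁻¹ * (W * C) = C := by
    rw [← Matrix.mul_assoc, Matrix.nonsing_inv_mul _ (isUnit_iff_ne_zero.2 hW), Matrix.one_mul]
  exact FieldType.swap (by rwa [e])

end FieldType

/-- The submodule `p` has a basis with respect to which `E` and `H` are given by matrices
over `U`. -/
def RatOn (U : Subfield ℝ) {τ : Type} (E H : Module.End ℝ (τ → ℝ)) (p : Submodule ℝ (τ → ℝ)) :
    Prop :=
  ∃ (ν : Type) (_ : Fintype ν) (v : ν → τ → ℝ), LinearIndependent ℝ v ∧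
    Submodule.span ℝ (Set.range v) = p ∧
    ∀ i, E (v i) ∈ Submodule.span U (Set.range v) ∧ H (v i) ∈ Submodule.span U (Set.range v)

section RatOn

variable {U : Subfield ℝ} {τ : Type} {E H : Module.End ℝ (τ → ℝ)}

lemma RatOn.sup {p q : Submodule ℝ (τ → ℝ)} (hp : RatOn U E H p) (hq : RatOn U E H q)
    (hpq : Disjoint p q) : RatOn U E H (p ⊔ q) := by
  obtain ⟨ν, _, v, hv, rfl, hEv⟩ := hp
  obtain ⟨μ, _, w, hw, rfl, hEw⟩ := hq
  refine ⟨ν ⊕ μ, inferInstance, Sum.elim v w, hv.sum_type hw hpq, ?_, ?_⟩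
  · rw [Set.Sum.elim_range, Submodule.span_union]
  · rw [Set.Sum.elim_range, Submodule.span_union]
    rintro (i | i)
    · exact ⟨Submodule.mem_sup_left (hEv i).1, Submodule.mem_sup_left (hEv i).2⟩
    · exact ⟨Submodule.mem_sup_right (hEw i).1, Submodule.mem_sup_right (hEw i).2⟩

/-- A Jordan chain of homogeneous vectors splits off from a graded nilpotent endomorphism. -/
lemma ratOn_of_nilpotent [Finite τ] (U : Subfield ℝ) (hE : ∀ u, E (E u) = E u)
    (hEH : ∀ u, E (H u) = H (u - E u)) (n : ℕ) (N : Submodule ℝ (τ → ℝ))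
    (hn : Module.finrank ℝ N = n) (hNE : ∀ u ∈ N, E u ∈ N) (hNH : ∀ u ∈ N, H u ∈ N)
    (hnil : ∃ k, ∀ u ∈ N, (H ^ k) u = 0) : RatOn U E H N := by
  classical
  induction n using Nat.strong_induction_on generalizing N with
  | _ n ih =>
  subst hn
  have hsucc : ∀ (j : ℕ) (u : τ → ℝ), (H ^ (j + 1)) u = (H ^ j) (H u) := fun j u => by
    rw [pow_succ]; rfl
  have hsucc' : ∀ (j : ℕ) (u : τ → ℝ), (H ^ (j + 1)) u = H ((H ^ j) u) := fun j u => by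
    rw [pow_succ']; rfl
  have hadd : ∀ (i j : ℕ) (u : τ → ℝ), (H ^ i) ((H ^ j) u) = (H ^ (i + j)) u := fun i j u => by
    rw [pow_add]; rfl
  rcases hk : Nat.find hnil with _ | k
  · have h0 := Nat.find_spec hnil
    rw [hk] at h0
    refine ⟨Empty, inferInstance, Empty.elim, linearIndependent_empty_type, ?_, fun i => i.elim⟩
    rw [Set.range_eq_empty, Submodule.span_empty, eq_comm, Submodule.eq_bot_iff]
    exact h0
  have hzero : ∀ u ∈ N, (H ^ (k + 1)) u = 0 := by
    have h0 := Nat.find_spec hnil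
    rwa [hk] at h0
  have hzero' : ∀ j, k + 1 ≤ j → ∀ u ∈ N, (H ^ j) u = 0 := fun j hj u hu => by
    obtain ⟨i, rfl⟩ := Nat.exists_eq_add_of_le' hj
    rw [← hadd, hzero u hu, map_zero]
  have hlt : ¬ ∀ u ∈ N, (H ^ k) u = 0 := Nat.find_min hnil (by omega)
  obtain ⟨x, hxN, hx, hxE⟩ : ∃ x ∈ N, (H ^ k) x ≠ 0 ∧ (E x = x ∨ E x = 0) := by
    push Not at hlt
    obtain ⟨u, hu, hu0⟩ := hlt
    by_cases h : (H ^ k) (E u) = 0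
    · refine ⟨u - E u, N.sub_mem hu (hNE u hu), ?_, Or.inr ?_⟩
      · rwa [map_sub, h, sub_zero]
      · rw [map_sub, hE, sub_self]
    · exact ⟨E u, hNE u hu, h, Or.inl (hE u)⟩
  have hchainE : ∀ j, E ((H ^ j) x) = (H ^ j) x ∨ E ((H ^ j) x) = 0 := fun j => by
    induction j with
    | zero => exact hxE
    | succ j ihj =>
      rw [hsucc', hEH]
      rcases ihj with h | h <;> rw [h]
      · right; rw [sub_self, map_zero]
      · left; rw [sub_zero]
  have hchainN : ∀ j, ∀ u ∈ N, (H ^ j) u ∈ N := fun j => by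
    induction j with
    | zero => exact fun u hu => hu
    | succ j ihj => exact fun u hu => by rw [hsucc']; exact hNH _ (ihj u hu)
  obtain ⟨φ, hφ1, hφE⟩ : ∃ φ : (τ → ℝ) →ₗ[ℝ] ℝ, φ ((H ^ k) x) = 1 ∧
      ((∀ u, φ (E u) = φ u) ∨ ∀ u, φ (E u) = 0) := by
    obtain ⟨t, ht⟩ := Function.ne_iff.1 hx
    let ψ : (τ → ℝ) →ₗ[ℝ] ℝ := ((H ^ k) x t)⁻¹ • LinearMap.proj t
    have hψ : ψ ((H ^ k) x) = 1 := inv_mul_cancel₀ ht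
    rcases hchainE k with h | h
    · exact ⟨ψ ∘ₗ E, by rw [LinearMap.comp_apply, h, hψ], Or.inl fun u => by
        rw [LinearMap.comp_apply, LinearMap.comp_apply, hE]⟩
    · refine ⟨ψ - ψ ∘ₗ E, ?_, Or.inr fun u => ?_⟩
      · rw [LinearMap.sub_apply, LinearMap.comp_apply, h, hψ, map_zero, sub_zero]
      · rw [LinearMap.sub_apply, LinearMap.comp_apply, hE, sub_self]
  have hφH : ∀ u j, φ ((H ^ j) u) = 0 → φ ((H ^ j) (E u)) = 0 := fun u j => by
    have : ∀ j, (∀ u, (H ^ j) (E u) = E ((H ^ j) u)) ∨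
        ∀ u, (H ^ j) (E u) = (H ^ j) u - E ((H ^ j) u) := fun j => by
      induction j with
      | zero => exact Or.inl fun u => rfl
      | succ j ihj =>
        have hHE : ∀ u, H (E u) = H u - E (H u) := fun u => by
          rw [hEH, map_sub, sub_sub_cancel]
        rcases ihj with h | h
        · refine Or.inr fun u => ?_
          rw [hsucc', hsucc', h, hHE]
        · refine Or.inl fun u => ?_
          rw [hsucc', hsucc', h, map_sub, hHE, sub_sub_cancel]
    intro h0
    rcases this j with h | h <;> rw [h] <;> rcases hφE with h' | h' <;>
      simp only [map_sub, h', h0, sub_self]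
  let Φ : (τ → ℝ) →ₗ[ℝ] (Fin (k + 1) → ℝ) := LinearMap.pi fun i => φ ∘ₗ (H ^ (i : ℕ))
  have hΦ : ∀ u i, Φ u i = φ ((H ^ (i : ℕ)) u) := fun _ _ => rfl
  let v : Fin (k + 1) → τ → ℝ := fun j => (H ^ (j : ℕ)) x
  have hinj : ∀ c : Fin (k + 1) → ℝ, Φ (∑ j, c j • v j) = 0 → c = 0 := by
    intro c hc
    have main : ∀ (j : ℕ) (hj : j < k + 1), c ⟨j, hj⟩ = 0 := by
      intro j
      induction j using Nat.strong_induction_on with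
      | _ j ihj =>
      intro hj
      have h1 := congrFun hc ⟨k - j, by omega⟩
      rw [hΦ, map_sum, map_sum, Finset.sum_eq_single ⟨j, hj⟩] at h1
      · simp only [v, map_smul, hadd, Nat.sub_add_cancel (Nat.lt_succ_iff.1 hj), hφ1,
          smul_eq_mul, mul_one] at h1
        exact h1
      · rintro ⟨i, hi⟩ _ hne
        have hne' : i ≠ j := fun h => hne (Fin.ext h)
        rcases lt_or_gt_of_ne hne' with h | h
        · rw [ihj i h hi, zero_smul, map_zero, map_zero]
        · simp only [v, map_smul, hadd]
          rw [hzero' _ (by omega) x hxN, map_zero, smul_zero]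
      · exact fun h => (h (Finset.mem_univ _)).elim
    exact funext fun j => main j j.2
  let V : (Fin (k + 1) → ℝ) →ₗ[ℝ] (τ → ℝ) := Fintype.linearCombination ℝ v
  have hV : ∀ c, V c = ∑ j, c j • v j := fun c => Fintype.linearCombination_apply ℝ v c
  have hΦVinj : Function.Injective (Φ ∘ₗ V) := by
    rw [← LinearMap.ker_eq_bot, LinearMap.ker_eq_bot']
    intro c hc
    exact hinj c (by rw [← hV]; exact hc)
  have hΦVsurj : Function.Surjective (Φ ∘ₗ V) := LinearMap.injective_iff_surjective.1 hΦVinj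
  have hvli : LinearIndependent ℝ v := by
    rw [Fintype.linearIndependent_iff]
    intro c hc
    exact congrFun (hinj c (by rw [hc, map_zero]))
  let N' : Submodule ℝ (τ → ℝ) := N ⊓ LinearMap.ker Φ
  have hspanN : Submodule.span ℝ (Set.range v) ≤ N := by
    rw [Submodule.span_le]
    rintro _ ⟨j, rfl⟩
    exact hchainN j x hxN
  have hdisj : Disjoint (Submodule.span ℝ (Set.range v)) N' := by
    rw [Submodule.disjoint_def]
    intro u hu hu'
    obtain ⟨c, rfl⟩ := (Submodule.mem_span_range_iff_exists_fun ℝ).1 hu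
    rw [hinj c hu'.2]
    simp
  have hsup : Submodule.span ℝ (Set.range v) ⊔ N' = N := by
    refine le_antisymm (sup_le hspanN inf_le_left) fun u hu => ?_
    obtain ⟨c, hc⟩ := hΦVsurj (Φ u)
    have hVc : V c ∈ Submodule.span ℝ (Set.range v) := by
      rw [hV]
      exact (Submodule.mem_span_range_iff_exists_fun ℝ).2 ⟨c, rfl⟩
    refine Submodule.mem_sup.2 ⟨V c, hVc, u - V c, ⟨N.sub_mem hu (hspanN hVc), ?_⟩, by abel⟩
    rw [SetLike.mem_coe, LinearMap.mem_ker, map_sub, sub_eq_zero]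
    exact hc.symm
  have hN' : RatOn U E H N' := by
    refine ih _ ?_ N' rfl ?_ ?_ ?_
    · refine Submodule.finrank_lt_finrank_of_lt (lt_of_le_of_ne inf_le_left fun h => ?_)
      have hx' : x ∈ N' := h ▸ hxN
      have := congrFun (LinearMap.mem_ker.1 hx'.2) ⟨k, by omega⟩
      rw [hΦ] at this
      simp only [hφ1] at this
      exact one_ne_zero this
    · refine fun u hu => ⟨hNE u hu.1, LinearMap.mem_ker.2 (funext fun i => ?_)⟩
      exact hφH u i (congrFun (LinearMap.mem_ker.1 hu.2) i)
    · refine fun u hu => ⟨hNH u hu.1, LinearMap.mem_ker.2 (funext fun i => ?_)⟩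
      rw [hΦ, ← hsucc]
      rcases Nat.lt_or_ge (i + 1) (k + 1) with h | h
      · exact congrFun (LinearMap.mem_ker.1 hu.2) ⟨i + 1, h⟩
      · rw [hzero' _ h u hu.1, map_zero]; rfl
    · exact ⟨k + 1, fun u hu => hzero u hu.1⟩
  rw [← hsup]
  refine RatOn.sup ⟨_, inferInstance, v, hvli, rfl, fun j => ⟨?_, ?_⟩⟩ hN' hdisj
  · rcases hchainE j with h | h
    · simp only [v]
      rw [h]
      exact Submodule.subset_span ⟨j, rfl⟩
    · simp only [v]
      rw [h]
      exact Submodule.zero_mem _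
  · simp only [v]
    rw [← hsucc']
    rcases Nat.lt_or_ge (j + 1) (k + 1) with h | h
    · exact Submodule.subset_span ⟨⟨j + 1, h⟩, rfl⟩
    · rw [hzero' _ h x hxN]
      exact Submodule.zero_mem _

end RatOn

section RationalForm

variable {U : Subfield ℝ} {τ δ : Type} [Fintype τ] [DecidableEq τ] [Fintype δ]

lemma mul_col_mem_span {E : Matrix τ τ ℝ} {G : Matrix τ δ ℝ} {e : Matrix δ δ ℝ}
    (he : OverField U e) (hE : E * G = G * e) (j : δ) :
    Matrix.toLin' E (G.col j) ∈ Submodule.span U (Set.range G.col) := by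
  have : Matrix.toLin' E (G.col j) = ∑ i, (⟨e i j, he i j⟩ : U) • G.col i := by
    ext a
    have h := congrFun (congrFun hE a) j
    rw [Matrix.mul_apply, Matrix.mul_apply] at h
    rw [Matrix.toLin'_apply, Finset.sum_apply]
    refine h.trans (Finset.sum_congr rfl fun i _ => ?_)
    rw [Pi.smul_apply, Subfield.smul_def, smul_eq_mul, mul_comm]
    rfl
  rw [this]
  exact Submodule.sum_mem _ fun i _ =>
    Submodule.smul_mem _ _ (Submodule.subset_span ⟨i, rfl⟩)

lemma ratOn_top_of_splitting [DecidableEq δ] {E H : Matrix τ τ ℝ}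
    (hE : E * E = E) (hEH : E * H = H * (1 - E))
    {G : Matrix τ δ ℝ} {K : Matrix δ τ ℝ} {e h T : Matrix δ δ ℝ} (he : OverField U e)
    (hh : OverField U h) (hKG : K * G = 1) (hEG : E * G = G * e) (hHG : H * G = G * h)
    (hKE : K * E = e * K) (hKH : K * H = h * K) {q : ℕ} (hq : H ^ q = G * T * K) :
    RatOn U (Matrix.toLin' E) (Matrix.toLin' H) ⊤ := by
  have hcols : ∀ c : δ → ℝ, ∑ i, c i • G.col i = G *ᵥ c := fun c => by
    ext a
    simp [Matrix.mulVec, dotProduct, mul_comm]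
  have hKcols : ∀ c : δ → ℝ, K *ᵥ (∑ i, c i • G.col i) = c := fun c => by
    rw [hcols, Matrix.mulVec_mulVec, hKG, Matrix.one_mulVec]
  have hli : LinearIndependent ℝ G.col := by
    rw [Fintype.linearIndependent_iff]
    intro c hc
    have := hKcols c
    rw [hc, Matrix.mulVec_zero] at this
    exact fun i => (congrFun this i).symm
  let N := LinearMap.ker (Matrix.toLin' K)
  have hN : ∀ u, u ∈ N ↔ K *ᵥ u = 0 := fun u => by
    rw [LinearMap.mem_ker, Matrix.toLin'_apply]
  have h1 : RatOn U (Matrix.toLin' E) (Matrix.toLin' H) (Submodule.span ℝ (Set.range G.col)) :=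
    ⟨δ, inferInstance, G.col, hli, rfl,
      fun j => ⟨mul_col_mem_span he hEG j, mul_col_mem_span hh hHG j⟩⟩
  have h2 : RatOn U (Matrix.toLin' E) (Matrix.toLin' H) N := by
    refine ratOn_of_nilpotent U (fun u => ?_) (fun u => ?_) _ N rfl (fun u hu => ?_)
      (fun u hu => ?_) ⟨q, fun u hu => ?_⟩
    · simp only [Matrix.toLin'_apply]
      rw [Matrix.mulVec_mulVec, hE]
    · simp only [Matrix.toLin'_apply]
      rw [Matrix.mulVec_mulVec, hEH, ← Matrix.mulVec_mulVec, Matrix.sub_mulVec, Matrix.one_mulVec]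
    · rw [hN] at hu ⊢
      rw [Matrix.toLin'_apply, Matrix.mulVec_mulVec, hKE, ← Matrix.mulVec_mulVec, hu,
        Matrix.mulVec_zero]
    · rw [hN] at hu ⊢
      rw [Matrix.toLin'_apply, Matrix.mulVec_mulVec, hKH, ← Matrix.mulVec_mulVec, hu,
        Matrix.mulVec_zero]
    · rw [hN] at hu
      rw [← Matrix.toLin'_pow, Matrix.toLin'_apply, hq, ← Matrix.mulVec_mulVec, hu,
        Matrix.mulVec_zero]
  have hdisj : Disjoint (Submodule.span ℝ (Set.range G.col)) N := by
    rw [Submodule.disjoint_def]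
    intro u hu hu'
    obtain ⟨c, rfl⟩ := (Submodule.mem_span_range_iff_exists_fun ℝ).1 hu
    rw [hN, hKcols] at hu'
    simp [hu']
  have hsup : Submodule.span ℝ (Set.range G.col) ⊔ N = ⊤ := by
    rw [eq_top_iff]
    intro u _
    refine Submodule.mem_sup.2 ⟨G *ᵥ (K *ᵥ u), ?_, u - G *ᵥ (K *ᵥ u), ?_, by abel⟩
    · rw [← hcols]
      exact (Submodule.mem_span_range_iff_exists_fun ℝ).2 ⟨_, rfl⟩
    · rw [hN, Matrix.mulVec_sub, Matrix.mulVec_mulVec, hKG, Matrix.one_mulVec, sub_self]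
  rw [← hsup]
  exact h1.sup h2 hdisj

lemma RatOn.exists_matrix {E H : Matrix τ τ ℝ}
    (h : RatOn U (Matrix.toLin' E) (Matrix.toLin' H) ⊤) :
    ∃ G e h : Matrix τ τ ℝ, G.det ≠ 0 ∧ OverField U e ∧ OverField U h ∧ E * G = G * e ∧
      H * G = G * h := by
  obtain ⟨ν, _, v, hv, hspan, hEH⟩ := h
  have hcard : Fintype.card ν = Fintype.card τ := by
    have := finrank_span_eq_card hv
    rw [hspan, finrank_top, Module.finrank_fintype_fun_eq_card] at this
    exact this.symm
  let σ := Fintype.equivOfCardEq hcard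
  let w : τ → τ → ℝ := v ∘ σ.symm
  have hw : Set.range w = Set.range v := EquivLike.range_comp v σ.symm
  let G : Matrix τ τ ℝ := Matrix.of fun i j => w j i
  have key : ∀ F : Matrix τ τ ℝ, (∀ i, Matrix.toLin' F (v i) ∈ Submodule.span U (Set.range v)) →
      ∃ f : Matrix τ τ ℝ, OverField U f ∧ F * G = G * f := fun F hF => by
    have h' : ∀ j, ∃ c : τ → U, ∑ i, c i • w i = Matrix.toLin' F (w j) := fun j => by
      rw [← Submodule.mem_span_range_iff_exists_fun, hw]
      exact hF _
    choose c hc using h'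
    refine ⟨Matrix.of fun i j => (c j i : ℝ), fun i j => (c j i).2, ?_⟩
    ext a j
    have := congrFun (hc j) a
    rw [Matrix.mul_apply, Matrix.mul_apply]
    rw [Matrix.toLin'_apply, Finset.sum_apply] at this
    refine Eq.trans this.symm (Finset.sum_congr rfl fun i _ => ?_)
    rw [Pi.smul_apply, Subfield.smul_def, smul_eq_mul, mul_comm]
    rfl
  obtain ⟨e, he, heG⟩ := key E fun i => (hEH i).1
  obtain ⟨h, hh, hhG⟩ := key H fun i => (hEH i).2
  refine ⟨G, e, h, ?_, he, hh, heG, hhG⟩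
  have hG : LinearIndependent ℝ G.col := hv.comp _ σ.symm.injective
  have := Matrix.linearIndependent_cols_iff_isUnit.1 hG
  exact ((Matrix.isUnit_iff_isUnit_det G).1 this).ne_zero

end RationalForm

section Pair

variable {U : Subfield ℝ} {ι κ : Type} [Fintype ι] [Fintype κ] [DecidableEq ι] [DecidableEq κ]

lemma exists_rational_form {R : Matrix ι κ ℝ} {S : Matrix κ ι ℝ} (hC : FieldType U (R * S)) :
    ∃ G e h : Matrix (ι ⊕ κ) (ι ⊕ κ) ℝ, G.det ≠ 0 ∧ OverField U e ∧ OverField U h ∧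
      Matrix.fromBlocks 1 0 0 0 * G = G * e ∧ Matrix.fromBlocks 0 R S 0 * G = G * h := by
  obtain ⟨d, D, X, Y, p, h0, h1, h2, h3, h4, h5⟩ := hC
  have hDD : D * D⁻¹ = 1 := Matrix.mul_nonsing_inv _ h1
  have hDD' : D⁻¹ * D = 1 := Matrix.nonsing_inv_mul _ h1
  have hY : D⁻¹ * Y * R * S = Y := by
    rw [Matrix.mul_assoc _ R, Matrix.mul_assoc, h3, ← Matrix.mul_assoc, hDD', Matrix.one_mul]
  have hpow : ∀ q, (Matrix.fromBlocks 0 R S 0 : Matrix (ι ⊕ κ) (ι ⊕ κ) ℝ) ^ (2 * q) =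
      Matrix.fromBlocks ((R * S) ^ q) 0 0 ((S * R) ^ q) := fun q => by
    induction q with
    | zero => simp
    | succ q ih =>
      rw [mul_add, mul_one, pow_add, ih, pow_two, pow_succ, pow_succ]
      simp [Matrix.fromBlocks_multiply]
  refine RatOn.exists_matrix (ratOn_top_of_splitting (δ := Fin d ⊕ Fin d)
    (G := Matrix.fromBlocks X 0 0 (S * X)) (K := Matrix.fromBlocks Y 0 0 (D⁻¹ * Y * R))
    (e := Matrix.fromBlocks 1 0 0 0) (h := Matrix.fromBlocks 0 D 1 0)
    (T := Matrix.fromBlocks (D ^ (p + 1)) 0 0 (D ^ (p + 1))) (q := 2 * (p + 1))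
    ?_ ?_ ?_ ?_ ?_ ?_ ?_ ?_ ?_ ?_)
  · simp [Matrix.fromBlocks_multiply]
  · rw [Matrix.mul_sub, Matrix.mul_one, eq_sub_iff_add_eq]
    simp [Matrix.fromBlocks_multiply, Matrix.fromBlocks_add]
  · rintro (i | i) (j | j)
    exacts [OverField.one i j, zero_mem U, zero_mem U, zero_mem U]
  · rintro (i | i) (j | j)
    exacts [zero_mem U, h0 i j, OverField.one i j, zero_mem U]
  · rw [Matrix.fromBlocks_multiply, ← Matrix.fromBlocks_one]
    simp only [Matrix.mul_zero, Matrix.zero_mul, add_zero, zero_add, h4]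
    rw [← Matrix.mul_assoc, hY, h4]
  · simp [Matrix.fromBlocks_multiply]
  · simp [Matrix.fromBlocks_multiply, ← Matrix.mul_assoc, h2]
  · simp [Matrix.fromBlocks_multiply]
  · rw [Matrix.fromBlocks_multiply, Matrix.fromBlocks_multiply]
    simp only [Matrix.mul_zero, Matrix.zero_mul, add_zero, zero_add, hY, Matrix.one_mul]
    rw [← Matrix.mul_assoc, ← Matrix.mul_assoc, hDD, Matrix.one_mul]
  · have a1 : (R * S) ^ (p + 1) = X * D ^ (p + 1) * Y := by
      rw [pow_succ, h5, Matrix.mul_assoc, h3, pow_succ]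
      simp only [Matrix.mul_assoc]
    have a2 : (S * R) ^ (p + 1) = S * X * D ^ (p + 1) * (D⁻¹ * Y * R) := by
      rw [mul_pow_comm_mul, h5, pow_succ]
      have hY' : Y = D * (D⁻¹ * Y) := by
        rw [← Matrix.mul_assoc, hDD, Matrix.one_mul]
      calc S * (X * D ^ p * Y) * R = S * (X * D ^ p * (D * (D⁻¹ * Y))) * R := by rw [← hY']
        _ = S * X * (D ^ p * D) * (D⁻¹ * Y * R) := by simp only [Matrix.mul_assoc]
    rw [hpow, a1, a2, Matrix.fromBlocks_multiply, Matrix.fromBlocks_multiply]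
    simp

lemma frequently_overField_pair {R : Matrix ι κ ℝ} {S : Matrix κ ι ℝ}
    (hC : FieldType U (R * S)) :
    ∃ᶠ q : Matrix ι ι ℝ × Matrix κ κ ℝ in 𝓝 (1, 1), (q.1.det ≠ 0 ∧ q.2.det ≠ 0) ∧
      OverField U (q.1 * R * q.2⁻¹) ∧ OverField U (q.2 * S * q.1⁻¹) := by
  obtain ⟨G, e, h, hG, he, hh, heG, hhG⟩ := exists_rational_form hC
  have hGi : G⁻¹ * G = 1 := Matrix.nonsing_inv_mul _ (isUnit_iff_ne_zero.2 hG)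
  have hGi' : G * G⁻¹ = 1 := Matrix.mul_nonsing_inv _ (isUnit_iff_ne_zero.2 hG)
  have hEU : OverField U (Matrix.fromBlocks 1 0 0 0 : Matrix (ι ⊕ κ) (ι ⊕ κ) ℝ) := by
    rintro (i | i) (j | j)
    exacts [OverField.one i j, zero_mem U, zero_mem U, zero_mem U]
  have hcl := mem_closure_iff_frequently.1 (mem_closure_intertwiners (U := U) (fun _ : Unit => e)
    (fun _ : Unit => Matrix.fromBlocks 1 0 0 0) (fun _ => he) (fun _ => hEU) G
    (fun _ => heG.symm))
  have hc : Tendsto (fun γ : Matrix (ι ⊕ κ) (ι ⊕ κ) ℝ =>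
      ((γ * G⁻¹).toBlocks₁₁, (γ * G⁻¹).toBlocks₂₂)) (𝓝 G) (𝓝 (1, 1)) := by
    have c0 : Continuous fun γ : Matrix (ι ⊕ κ) (ι ⊕ κ) ℝ => γ * G⁻¹ := by fun_prop
    have : Continuous (fun γ : Matrix (ι ⊕ κ) (ι ⊕ κ) ℝ =>
      ((γ * G⁻¹).toBlocks₁₁, (γ * G⁻¹).toBlocks₂₂)) :=
      (continuous_matrix fun i j => c0.matrix_elem _ _).prodMk
        (continuous_matrix fun i j => c0.matrix_elem _ _)
    have h2 := this.tendsto G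
    rw [hGi', ← Matrix.fromBlocks_one, Matrix.toBlocks_fromBlocks₁₁,
      Matrix.toBlocks_fromBlocks₂₂] at h2
    exact h2
  have d1 := hc.eventually (continuousAt_fst.eventually
    (eventually_det_ne_zero (M := (1 : Matrix ι ι ℝ)) (by simp)))
  have d2 := hc.eventually (continuousAt_snd.eventually
    (eventually_det_ne_zero (M := (1 : Matrix κ κ ℝ)) (by simp)))
  refine hc.frequently ((hcl.and_eventually ((eventually_det_ne_zero hG).and (d1.and d2))).mono ?_)
  rintro γ ⟨⟨hγ, hγe⟩, hγd, hZ, hW⟩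
  have hγe := hγe ()
  have hγi : γ⁻¹ * γ = 1 := Matrix.nonsing_inv_mul _ (isUnit_iff_ne_zero.2 hγd)
  simp only at hZ hW ⊢
  set N := γ * G⁻¹ with hN
  have hNE : N * Matrix.fromBlocks 1 0 0 0 = Matrix.fromBlocks 1 0 0 0 * N := by
    calc N * Matrix.fromBlocks 1 0 0 0
        = γ * G⁻¹ * (Matrix.fromBlocks 1 0 0 0 * G) * G⁻¹ := by
          simp only [hN, Matrix.mul_assoc, hGi', Matrix.mul_one]
      _ = γ * (G⁻¹ * G) * e * G⁻¹ := by rw [heG]; simp only [Matrix.mul_assoc]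
      _ = Matrix.fromBlocks 1 0 0 0 * N := by rw [hGi, Matrix.mul_one, hγe, Matrix.mul_assoc]
  have hblocks : N = Matrix.fromBlocks N.toBlocks₁₁ 0 0 N.toBlocks₂₂ := by
    have h0 := Matrix.fromBlocks_toBlocks N
    rw [← h0, Matrix.fromBlocks_multiply, Matrix.fromBlocks_multiply] at hNE
    simp only [Matrix.mul_one, Matrix.mul_zero, Matrix.one_mul, Matrix.zero_mul, add_zero,
      Matrix.fromBlocks_inj] at hNE
    conv_lhs => rw [← h0, ← hNE.2.1, hNE.2.2.1]
  have hNH : N * Matrix.fromBlocks 0 R S 0 = γ * h * γ⁻¹ * N := by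
    calc N * Matrix.fromBlocks 0 R S 0
        = γ * G⁻¹ * (Matrix.fromBlocks 0 R S 0 * G) * G⁻¹ := by
          simp only [hN, Matrix.mul_assoc, hGi', Matrix.mul_one]
      _ = γ * (G⁻¹ * G) * h * G⁻¹ := by rw [hhG]; simp only [Matrix.mul_assoc]
      _ = γ * h * (γ⁻¹ * γ) * G⁻¹ := by rw [hGi, hγi, Matrix.mul_one, Matrix.mul_one]
      _ = γ * h * γ⁻¹ * N := by rw [hN]; simp only [Matrix.mul_assoc]
  have hU : OverField U (γ * h * γ⁻¹) := (OverField.mul hγ hh).mul hγ.inv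
  set L := γ * h * γ⁻¹
  set Z := N.toBlocks₁₁
  set W := N.toBlocks₂₂
  rw [hblocks, ← Matrix.fromBlocks_toBlocks L, Matrix.fromBlocks_multiply,
    Matrix.fromBlocks_multiply] at hNH
  simp only [Matrix.mul_zero, Matrix.zero_mul, add_zero, zero_add, Matrix.fromBlocks_inj] at hNH
  refine ⟨⟨hZ, hW⟩, ?_, ?_⟩
  · rw [hNH.2.1, Matrix.mul_assoc, Matrix.mul_nonsing_inv _ (isUnit_iff_ne_zero.2 hW),
      Matrix.mul_one]
    exact fun i j => hU _ _
  · rw [hNH.2.2.1, Matrix.mul_assoc, Matrix.mul_nonsing_inv _ (isUnit_iff_ne_zero.2 hZ),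
      Matrix.mul_one]
    exact fun i j => hU _ _

variable {p₀ : (n : ℕ) × Matrix (Fin n) (Fin n) ℝ}

lemma Reach.swap [Nonempty ι] [Nonempty κ] {R : Matrix ι κ ℝ} {S : Matrix κ ι ℝ}
    (hC : FieldType U (R * S)) (hR : AllPos R) (hS : AllPos S) (h : Reach U p₀ (R * S)) :
    Reach U p₀ (S * R) := by
  refine reach_of_frequently (hS.mul hR) ?_
  have c1 : ContinuousAt (fun q : Matrix ι ι ℝ × Matrix κ κ ℝ => q.1) (1, 1) := continuousAt_fst
  have c2 : ContinuousAt (fun q : Matrix ι ι ℝ × Matrix κ κ ℝ => q.2) (1, 1) := continuousAt_snd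
  have c1i : ContinuousAt (fun q : Matrix ι ι ℝ × Matrix κ κ ℝ => q.1⁻¹) (1, 1) :=
    ContinuousAt.comp (g := fun N : Matrix ι ι ℝ => N⁻¹)
      (continuousAt_inv_of_det_ne_zero (by simp)) c1
  have c2i : ContinuousAt (fun q : Matrix ι ι ℝ × Matrix κ κ ℝ => q.2⁻¹) (1, 1) :=
    ContinuousAt.comp (g := fun N : Matrix κ κ ℝ => N⁻¹)
      (continuousAt_inv_of_det_ne_zero (by simp)) c2
  have hmul : ∀ {α β γ : Type} [Fintype β] {F : Matrix ι ι ℝ × Matrix κ κ ℝ → Matrix α β ℝ}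
      {F' : Matrix ι ι ℝ × Matrix κ κ ℝ → Matrix β γ ℝ}, ContinuousAt F (1, 1) →
      ContinuousAt F' (1, 1) → ContinuousAt (fun q => F q * F' q) (1, 1) := fun hF hF' =>
    ContinuousAt.comp (g := fun x : _ × _ => x.1 * x.2)
      (Continuous.matrix_mul continuous_fst continuous_snd).continuousAt (hF.prodMk hF')
  have e1 := (hmul (hmul c1 (continuousAt_const (y := R))) c2i).eventually
    (isOpen_allPos.eventually_mem (by simpa using hR))
  have e2 := (hmul (hmul c2 (continuousAt_const (y := S))) c1i).eventually
    (isOpen_allPos.eventually_mem (by simpa using hS))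
  have e3 := c1.eventually (h : ∀ᶠ W in 𝓝 (1 : Matrix ι ι ℝ), _)
  have hfr := (frequently_overField_pair hC).and_eventually (e1.and (e2.and e3))
  refine c2.tendsto.frequently (hfr.mono ?_)
  rintro ⟨Z, W⟩ ⟨⟨⟨hZ, hW⟩, hZR, hWS⟩, hp, hp', hL⟩
  simp only [Set.mem_ofPred_eq] at hZ hW hZR hWS hp hp' hL ⊢
  have f1 : Z * R * W⁻¹ * (W * S * Z⁻¹) = Z * (R * S) * Z⁻¹ := by
    calc Z * R * W⁻¹ * (W * S * Z⁻¹) = Z * R * (W⁻¹ * W) * S * Z⁻¹ := by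
          simp only [Matrix.mul_assoc]
      _ = Z * (R * S) * Z⁻¹ := by
          rw [Matrix.nonsing_inv_mul _ (isUnit_iff_ne_zero.2 hW), Matrix.mul_one,
            Matrix.mul_assoc Z]
  have f2 : W * S * Z⁻¹ * (Z * R * W⁻¹) = W * (S * R) * W⁻¹ := by
    calc W * S * Z⁻¹ * (Z * R * W⁻¹) = W * S * (Z⁻¹ * Z) * R * W⁻¹ := by
          simp only [Matrix.mul_assoc]
      _ = W * (S * R) * W⁻¹ := by
          rw [Matrix.nonsing_inv_mul _ (isUnit_iff_ne_zero.2 hZ), Matrix.mul_one,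
            Matrix.mul_assoc W]
  rw [← f1] at hL
  rw [← f2]
  exact ⟨hWS.mul hZR, (hL (hZR.mul hWS)).step hZR hWS (fun i j => (hp i j).le)
    (fun i j => (hp' i j).le) (hp.mul hp') (hp'.mul hp)⟩

end Pair

lemma mul_nonneg_entry {ι κ μ : Type*} [Fintype κ] {M : Matrix ι κ ℝ}
    {N : Matrix κ μ ℝ} (hM : ∀ i j, 0 ≤ M i j) (hN : ∀ i j, 0 ≤ N i j) (i : ι) (j : μ) :
    0 ≤ (M * N) i j := by
  rw [Matrix.mul_apply]
  exact Finset.sum_nonneg fun k _ => mul_nonneg (hM _ _) (hN _ _)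

section Cone

variable {U : Subfield ℝ} {p₀ : (n : ℕ) × Matrix (Fin n) (Fin n) ℝ} {ι κ : Type} [Fintype ι]
  [Fintype κ]

/-- `z` is an infinitesimal conjugation of the pair making the zero entries of `R` positive. -/
def Lifts (R : Matrix ι κ ℝ) (z : Matrix ι ι ℝ) (w : Matrix κ κ ℝ) : Prop :=
  ∀ i j, R i j = 0 → 0 < (z * R - R * w) i j

lemma Lifts.mul_left {μ : Type} [Fintype μ] {R : Matrix ι κ ℝ} {S : Matrix κ μ ℝ}
    {z : Matrix ι ι ℝ} {w : Matrix κ κ ℝ} {v : Matrix μ μ ℝ} (hR : ∀ i j, 0 ≤ R i j)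
    (hS : ∀ i j, 0 ≤ S i j) (hzw : Lifts R z w) (hwv : Lifts S w v)
    (h : (∀ i, ∃ k, R i k ≠ 0) ∨ ∀ j, ∃ k, S k j ≠ 0) : Lifts (R * S) z v := by
  intro i j hij
  have e : z * (R * S) - R * S * v = (z * R - R * w) * S + R * (w * S - S * v) := by
    rw [Matrix.sub_mul, Matrix.mul_sub]
    simp only [Matrix.mul_assoc]
    abel
  have hzero : ∀ k, R i k = 0 ∨ S k j = 0 := fun k => by
    rw [Matrix.mul_apply, Finset.sum_eq_zero_iff_of_nonneg
      (fun k _ => mul_nonneg (hR _ _) (hS _ _))] at hij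
    exact mul_eq_zero.1 (hij k (Finset.mem_univ k))
  have n1 : ∀ k, 0 ≤ (z * R - R * w) i k * S k j := fun k => by
    rcases hzero k with h | h
    · exact mul_nonneg (hzw _ _ h).le (hS _ _)
    · rw [h, mul_zero]
  have n2 : ∀ k, 0 ≤ R i k * (w * S - S * v) k j := fun k => by
    rcases hzero k with h | h
    · rw [h, zero_mul]
    · exact mul_nonneg (hR _ _) (hwv _ _ h).le
  rw [e, Matrix.add_apply, Matrix.mul_apply, Matrix.mul_apply]
  rcases h with h | h
  · obtain ⟨k, hk⟩ := h i
    refine add_pos_of_nonneg_of_pos (Finset.sum_nonneg fun k _ => n1 k)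
      (Finset.sum_pos' (fun k _ => n2 k) ⟨k, Finset.mem_univ k, ?_⟩)
    exact mul_pos ((hR i k).lt_of_ne' hk) (hwv _ _ ((hzero k).resolve_left hk))
  · obtain ⟨k, hk⟩ := h j
    refine add_pos_of_pos_of_nonneg
      (Finset.sum_pos' (fun k _ => n1 k) ⟨k, Finset.mem_univ k, ?_⟩)
      (Finset.sum_nonneg fun k _ => n2 k)
    exact mul_pos (hzw _ _ ((hzero k).resolve_right hk)) ((hS k j).lt_of_ne' hk)

lemma lifts_of_allPos {C : Matrix ι ι ℝ} (hC : AllPos C) (z : Matrix ι ι ℝ) : Lifts C z z :=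
  fun i j h => absurd h (hC i j).ne'

/-- The zero entries of `R` and of `S` can be made positive by an infinitesimal simultaneous
conjugation. -/
def GoodPair (R : Matrix ι κ ℝ) (S : Matrix κ ι ℝ) : Prop :=
  ∃ z w, Lifts R z w ∧ Lifts S w z

variable [DecidableEq ι] [DecidableEq κ]

lemma Lifts.eventually_allPos {X : Type*} [TopologicalSpace X] {R : Matrix ι κ ℝ}
    (hR : ∀ i j, 0 ≤ R i j) {z : X → Matrix ι ι ℝ} {w : X → Matrix κ κ ℝ} (hz : Continuous z)
    (hw : Continuous w) {s : X} (h : Lifts R (z s) (w s)) :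
    ∀ᶠ p : X × ℝ in 𝓝 (s, 0), (1 + p.2 • z p.1).det ≠ 0 ∧
      (0 < p.2 → AllPos ((1 + p.2 • z p.1) * R * (1 + p.2 • w p.1)⁻¹)) := by
  have cz : Continuous fun p : X × ℝ => 1 + p.2 • z p.1 := by fun_prop
  have cw : Continuous fun p : X × ℝ => 1 + p.2 • w p.1 := by fun_prop
  have dz : ∀ᶠ p : X × ℝ in 𝓝 (s, 0), (1 + p.2 • z p.1).det ≠ 0 :=
    cz.continuousAt.eventually (eventually_det_ne_zero (by simp))
  have dw : ∀ᶠ p : X × ℝ in 𝓝 (s, 0), (1 + p.2 • w p.1).det ≠ 0 :=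
    cw.continuousAt.eventually (eventually_det_ne_zero (by simp))
  have cwi : ContinuousAt (fun p : X × ℝ => (1 + p.2 • w p.1)⁻¹) (s, 0) :=
    ContinuousAt.comp (g := fun N : Matrix κ κ ℝ => N⁻¹)
      (continuousAt_inv_of_det_ne_zero (by simp)) cw.continuousAt
  have hmul : ∀ {F : X × ℝ → Matrix ι κ ℝ}, Continuous F →
      ContinuousAt (fun p => F p * (1 + p.2 • w p.1)⁻¹) (s, 0) := fun hF =>
    ContinuousAt.comp (g := fun x : Matrix ι κ ℝ × Matrix κ κ ℝ => x.1 * x.2)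
      (Continuous.matrix_mul continuous_fst continuous_snd).continuousAt
      (hF.continuousAt.prodMk cwi)
  have c1 : Continuous fun p : X × ℝ => (1 + p.2 • z p.1) * R := by fun_prop
  have c2 : Continuous fun p : X × ℝ => z p.1 * R - R * w p.1 := by fun_prop
  have entry : ∀ i j, ∀ᶠ p : X × ℝ in 𝓝 (s, 0),
      0 < p.2 → 0 < ((1 + p.2 • z p.1) * R * (1 + p.2 • w p.1)⁻¹ : Matrix ι κ ℝ) i j :=
      fun i j => by
    have ce : Continuous fun M : Matrix ι κ ℝ => M i j := by fun_prop
    rcases (hR i j).eq_or_lt with h0 | h0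
    · have := (ce.continuousAt.comp (hmul c2)).eventually (lt_mem_nhds (a := 0) (by
        simpa using h i j h0.symm))
      filter_upwards [this, dw] with p hp hd ht
      have e : (1 + p.2 • z p.1) * R * (1 + p.2 • w p.1)⁻¹ =
          R + p.2 • ((z p.1 * R - R * w p.1) * (1 + p.2 • w p.1)⁻¹) := by
        have e1 : (1 + p.2 • z p.1) * R = R * (1 + p.2 • w p.1) +
            p.2 • (z p.1 * R - R * w p.1) := by
          simp only [Matrix.add_mul, Matrix.mul_add, Matrix.one_mul, Matrix.mul_one,
            Matrix.smul_mul, Matrix.mul_smul, smul_sub]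
          abel
        rw [e1, Matrix.add_mul, Matrix.mul_assoc,
          Matrix.mul_nonsing_inv _ (isUnit_iff_ne_zero.2 hd), Matrix.mul_one, Matrix.smul_mul]
      rw [e, Matrix.add_apply, ← h0, zero_add, Matrix.smul_apply, smul_eq_mul]
      exact mul_pos ht hp
    · have := (ce.continuousAt.comp (hmul c1)).eventually (lt_mem_nhds (a := 0) (by
        simpa using h0))
      exact this.mono fun p hp _ => hp
  have := eventually_all.2 fun i => eventually_all.2 fun j => entry i j
  filter_upwards [dz, this] with p h1 h2
  exact ⟨h1, fun ht i j => h2 i j ht⟩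

lemma Lifts.eventually_allPos_nhdsGT {R : Matrix ι κ ℝ} (hR : ∀ i j, 0 ≤ R i j)
    {z : Matrix ι ι ℝ} {w : Matrix κ κ ℝ} (h : Lifts R z w) :
    ∀ᶠ t in 𝓝[>] (0 : ℝ), (1 + t • z).det ≠ 0 ∧ AllPos ((1 + t • z) * R * (1 + t • w)⁻¹) := by
  have h1 := Lifts.eventually_allPos hR (X := Unit) (z := fun _ => z) (w := fun _ => w)
    continuous_const continuous_const (s := ()) h
  have h2 := ((Continuous.prodMk_right ()).continuousAt (x := (0 : ℝ))).eventually h1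
  filter_upwards [h2.filter_mono nhdsWithin_le_nhds, self_mem_nhdsWithin] with t h3 h4
  exact ⟨h3.1, h3.2 h4⟩

/-- `Reach` for nonnegative matrices, after pushing them into the positive matrices. -/
def ReachLim (U : Subfield ℝ) (p₀ : (n : ℕ) × Matrix (Fin n) (Fin n) ℝ) (C : Matrix ι ι ℝ) :
    Prop :=
  FieldType U C ∧ ∃ z, Lifts C z z ∧
    ∀ᶠ t in 𝓝[>] (0 : ℝ), Reach U p₀ ((1 + t • z) * C * (1 + t • z)⁻¹)

lemma ReachLim.eventually {C : Matrix ι ι ℝ} (hC : ∀ i j, 0 ≤ C i j) (h : ReachLim U p₀ C)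
    {z : Matrix ι ι ℝ} (hz : Lifts C z z) :
    ∀ᶠ t in 𝓝[>] (0 : ℝ), Reach U p₀ ((1 + t • z) * C * (1 + t • z)⁻¹) := by
  obtain ⟨-, y, hy, hreach⟩ := h
  let f : unitInterval → Matrix ι ι ℝ := fun s => (1 - (s : ℝ)) • y + (s : ℝ) • z
  have hf : Continuous f := by fun_prop
  have hlift : ∀ s, Lifts C (f s) (f s) := fun s i j hij => by
    have e : f s * C - C * f s =
        (1 - (s : ℝ)) • (y * C - C * y) + (s : ℝ) • (z * C - C * z) := by
      simp only [f, Matrix.add_mul, Matrix.mul_add, Matrix.smul_mul, Matrix.mul_smul, smul_sub]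
      abel
    rw [e, Matrix.add_apply, Matrix.smul_apply, Matrix.smul_apply, smul_eq_mul, smul_eq_mul]
    have h1 := hy i j hij
    have h2 := hz i j hij
    rcases s.2.1.eq_or_lt with h0 | h0
    · rw [← h0]
      simpa using h1
    · exact add_pos_of_nonneg_of_pos (mul_nonneg (sub_nonneg.2 s.2.2) h1.le) (mul_pos h0 h2)
  have key := isCompact_univ.eventually_forall_of_forall_eventually (x₀ := (0 : ℝ))
    (P := fun (t : ℝ) (s : unitInterval) => (1 + t • f s).det ≠ 0 ∧
      (0 < t → AllPos ((1 + t • f s) * C * (1 + t • f s)⁻¹))) fun s _ =>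
    (continuous_swap.tendsto (0, s)).eventually (Lifts.eventually_allPos hC hf hf (hlift s))
  filter_upwards [key.filter_mono nhdsWithin_le_nhds, hreach, self_mem_nhdsWithin] with t h1 h2 h3
  have := Reach.of_path (U := U) (p₀ := p₀) (C := C) (fun s => 1 + t • f s) (by fun_prop)
    (fun s => (h1 s (Set.mem_univ s)).1) (fun s => (h1 s (Set.mem_univ s)).2 h3) (s := 0) (t := 1)
  simp only [f, Set.Icc.coe_zero, Set.Icc.coe_one, sub_zero, sub_self, zero_smul, one_smul,
    add_zero, zero_add] at this
  exact this h2

lemma Reach.reachLim {C : Matrix ι ι ℝ} (hC : AllPos C) (hF : FieldType U C)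
    (h : Reach U p₀ C) : ReachLim U p₀ C :=
  ⟨hF, 0, lifts_of_allPos hC 0, Eventually.of_forall fun t => by simpa using h⟩

lemma ReachLim.reach {C : Matrix ι ι ℝ} (hC : AllPos C) (h : ReachLim U p₀ C) :
    Reach U p₀ C := by
  have := h.eventually (fun i j => (hC i j).le) (lifts_of_allPos hC 0)
  simpa using this.exists

lemma ReachLim.swap_of_lifts [Nonempty ι] [Nonempty κ] {R : Matrix ι κ ℝ} {S : Matrix κ ι ℝ}
    (hR : ∀ i j, 0 ≤ R i j) (hS : ∀ i j, 0 ≤ S i j) {z : Matrix ι ι ℝ} {w : Matrix κ κ ℝ}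
    (h1 : Lifts R z w) (h2 : Lifts S w z) (h3 : Lifts (R * S) z z) (h4 : Lifts (S * R) w w)
    (h : ReachLim U p₀ (R * S)) : ReachLim U p₀ (S * R) := by
  refine ⟨h.1.swap, w, h4, ?_⟩
  filter_upwards [h.eventually (mul_nonneg_entry hR hS) h3, h1.eventually_allPos_nhdsGT hR,
    h2.eventually_allPos_nhdsGT hS] with t e1 e2 e3
  have iz := Matrix.nonsing_inv_mul _ (isUnit_iff_ne_zero.2 e2.1)
  have iw := Matrix.nonsing_inv_mul _ (isUnit_iff_ne_zero.2 e3.1)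
  have f1 : (1 + t • z) * R * (1 + t • w)⁻¹ * ((1 + t • w) * S * (1 + t • z)⁻¹) =
      (1 + t • z) * (R * S) * (1 + t • z)⁻¹ := by
    generalize 1 + t • z = Z at *
    generalize 1 + t • w = W at *
    calc Z * R * W⁻¹ * (W * S * Z⁻¹) = Z * R * (W⁻¹ * W) * S * Z⁻¹ := by
          simp only [Matrix.mul_assoc]
      _ = Z * (R * S) * Z⁻¹ := by rw [iw, Matrix.mul_one, Matrix.mul_assoc Z]
  have f2 : (1 + t • w) * S * (1 + t • z)⁻¹ * ((1 + t • z) * R * (1 + t • w)⁻¹) =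
      (1 + t • w) * (S * R) * (1 + t • w)⁻¹ := by
    generalize 1 + t • z = Z at *
    generalize 1 + t • w = W at *
    calc W * S * Z⁻¹ * (Z * R * W⁻¹) = W * S * (Z⁻¹ * Z) * R * W⁻¹ := by
          simp only [Matrix.mul_assoc]
      _ = W * (S * R) * W⁻¹ := by rw [iz, Matrix.mul_one, Matrix.mul_assoc W]
  rw [← f2]
  rw [← f1] at e1
  refine Reach.swap ?_ e2.2 e3.2 e1
  rw [f1]
  exact h.1.conj e2.1

/-- A matrix without zero rows and columns. -/
def Nondeg {ι κ : Type*} (S : Matrix ι κ ℝ) : Prop :=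
  (∀ i, ∃ j, S i j ≠ 0) ∧ ∀ j, ∃ i, S i j ≠ 0

lemma GoodPair.reachLim_iff [Nonempty ι] [Nonempty κ] {R : Matrix ι κ ℝ} {S : Matrix κ ι ℝ}
    (h : GoodPair R S) (hR : ∀ i j, 0 ≤ R i j) (hS : ∀ i j, 0 ≤ S i j) (hS' : Nondeg S) :
    ReachLim U p₀ (R * S) ↔ ReachLim U p₀ (S * R) := by
  obtain ⟨z, w, h1, h2⟩ := h
  have h3 := h1.mul_left hR hS h2 (Or.inr hS'.2)
  have h4 := h2.mul_left hS hR h1 (Or.inl hS'.1)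
  exact ⟨ReachLim.swap_of_lifts hR hS h1 h2 h3 h4, ReachLim.swap_of_lifts hS hR h2 h1 h4 h3⟩

end Cone

lemma pow_nonneg_entry {κ : Type*} [Fintype κ] [DecidableEq κ] {D : Matrix κ κ ℝ}
    (hD : ∀ i j, 0 ≤ D i j) (q : ℕ) : ∀ i j, 0 ≤ (D ^ q) i j := by
  induction q with
  | zero =>
    intro i j
    rw [pow_zero, Matrix.one_apply]
    split_ifs <;> norm_num
  | succ q ih =>
    rw [pow_succ]
    exact mul_nonneg_entry ih hD

section Criterion

variable {ι κ : Type} [Fintype ι] [Fintype κ]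

lemma GoodPair.of_transpose {R : Matrix ι κ ℝ} {S : Matrix κ ι ℝ} (h : GoodPair Rᵀ Sᵀ) :
    GoodPair R S := by
  obtain ⟨z, w, h1, h2⟩ := h
  refine ⟨-wᵀ, -zᵀ, fun i j hij => ?_, fun i j hij => ?_⟩
  · have e : -wᵀ * R - R * -zᵀ = (z * Rᵀ - Rᵀ * w)ᵀ := by
      simp only [Matrix.transpose_sub, Matrix.transpose_mul, Matrix.transpose_transpose,
        Matrix.neg_mul, Matrix.mul_neg]
      abel
    rw [e]
    exact h1 j i hij
  · have e : -zᵀ * S - S * -wᵀ = (w * Sᵀ - Sᵀ * z)ᵀ := by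
      simp only [Matrix.transpose_sub, Matrix.transpose_mul, Matrix.transpose_transpose,
        Matrix.neg_mul, Matrix.mul_neg]
      abel
    rw [e]
    exact h2 j i hij

/-- A row vector which `D` expands by more than `K` in every coordinate but `a`. -/
lemma exists_vecMul_gt [DecidableEq κ] {D : Matrix κ κ ℝ} (hD : ∀ i j, 0 ≤ D i j) (a : κ)
    (hreach : ∀ b, ∃ p : ℕ, 0 < (D ^ p) a b) {K : ℝ} (hK : 0 ≤ K) :
    ∃ f : κ → ℝ, (∀ b, 0 ≤ f b) ∧ ∀ b, b ≠ a → K * f b < (f ᵥ* D) b := by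
  choose p hp using hreach
  let P := Finset.univ.sup p
  let η : ℝ := (K + 1)⁻¹
  have hη : 0 < η := by positivity
  let f : κ → ℝ := fun b => ∑ q ∈ Finset.range (P + 1), η ^ q * (D ^ q) a b
  have term : ∀ b (q : ℕ), 0 ≤ η ^ q * (D ^ q) a b := fun b q =>
    mul_nonneg (pow_nonneg hη.le _) (pow_nonneg_entry hD _ _ _)
  have fpos : ∀ b, 0 < f b := fun b =>
    Finset.sum_pos' (fun q _ => term b q) ⟨p b, Finset.mem_range.2
      (Nat.lt_succ_of_le (Finset.le_sup (Finset.mem_univ b))), mul_pos (pow_pos hη _) (hp b)⟩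
  refine ⟨f, fun b => (fpos b).le, fun b hb => ?_⟩
  have e1 : η * (f ᵥ* D) b = ∑ q ∈ Finset.range (P + 1), η ^ (q + 1) * (D ^ (q + 1)) a b := by
    simp only [f, Matrix.vecMul, dotProduct, Finset.sum_mul, Finset.mul_sum]
    rw [Finset.sum_comm]
    refine Finset.sum_congr rfl fun q _ => ?_
    rw [pow_succ D, Matrix.mul_apply, Finset.mul_sum]
    exact Finset.sum_congr rfl fun j _ => by ring
  have e2 : f b ≤ η * (f ᵥ* D) b := by
    have h0 : η ^ 0 * (D ^ 0) a b = 0 := by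
      rw [pow_zero, pow_zero, Matrix.one_apply_ne hb.symm, mul_zero]
    calc f b ≤ f b + η ^ (P + 1) * (D ^ (P + 1)) a b := le_add_of_nonneg_right (term _ _)
      _ = ∑ q ∈ Finset.range (P + 1 + 1), η ^ q * (D ^ q) a b :=
          (Finset.sum_range_succ _ _).symm
      _ = η * (f ᵥ* D) b := by rw [Finset.sum_range_succ', h0, add_zero, e1]
  have e3 : (K + 1) * f b ≤ (f ᵥ* D) b := by
    have := mul_le_mul_of_nonneg_left e2 (by positivity : 0 ≤ K + 1)
    rwa [← mul_assoc, mul_inv_cancel₀ (by positivity), one_mul] at this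
  linarith [fpos b]

lemma GoodPair.of_column [DecidableEq κ] {R : Matrix ι κ ℝ} {S : Matrix κ ι ℝ}
    (hR : ∀ i j, 0 ≤ R i j) (hS : ∀ i j, 0 ≤ S i j) (hS0 : ∀ i, ∃ j, S i j ≠ 0) {a : κ}
    (ha : ∀ i, R i a ≠ 0)
    (hreach : ∀ b, ∃ p : ℕ, 0 < ((S * R) ^ p) a b) : GoodPair R S := by
  have hRS := mul_nonneg_entry hR hS
  have hSR := mul_nonneg_entry hS hR
  obtain ⟨f, hf, hexp⟩ := exists_vecMul_gt hSR a hreach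
    (K := ∑ i, ∑ k, (R * S) i k) (Finset.sum_nonneg fun i _ => Finset.sum_nonneg fun k _ => hRS _ _)
  let v : Matrix ι κ ℝ := Matrix.of fun _ j => f j
  let J : Matrix ι ι ℝ := Matrix.of fun _ _ => 1
  have hv : ∀ i b, b ≠ a → 0 < (v * (S * R) - R * S * v) i b := fun i b hb => by
    have h1 : (v * (S * R)) i b = (f ᵥ* (S * R)) b := rfl
    have h2 : (R * S * v) i b = (∑ k, (R * S) i k) * f b := by
      rw [Matrix.mul_apply, Finset.sum_mul]
      rfl
    rw [Matrix.sub_apply, h1, h2, sub_pos]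
    refine lt_of_le_of_lt (mul_le_mul_of_nonneg_right ?_ (hf b)) (hexp b hb)
    exact Finset.single_le_sum (f := fun i => ∑ k, (R * S) i k)
      (fun i _ => Finset.sum_nonneg fun k _ => hRS _ _) (Finset.mem_univ i)
  have hε : ∀ᶠ ε in 𝓝[>] (0 : ℝ), ∀ i b, b ≠ a →
      0 < (v * (S * R) - R * S * v - ε • (J * R)) i b := by
    refine Filter.Eventually.filter_mono nhdsWithin_le_nhds (eventually_all.2 fun i =>
      eventually_all.2 fun b => ?_)
    by_cases hb : b = a
    · exact Eventually.of_forall fun _ h => absurd hb h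
    · have hc : Continuous fun ε : ℝ => (v * (S * R) - R * S * v - ε • (J * R)) i b := by fun_prop
      have h0 : 0 < (v * (S * R) - R * S * v - (0 : ℝ) • (J * R)) i b := by
        rw [zero_smul, sub_zero]
        exact hv i b hb
      have := (hc.continuousAt (x := 0)).eventually (lt_mem_nhds h0)
      exact this.mono fun _ h _ => h
  obtain ⟨ε, hε, hε0⟩ := (hε.and self_mem_nhdsWithin).exists
  have hε0 : 0 < ε := hε0
  refine ⟨v * S - ε • J, S * v, fun i j hij => ?_, fun i j _ => ?_⟩
  · have e : (v * S - ε • J) * R - R * (S * v) = v * (S * R) - R * S * v - ε • (J * R) := by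
      rw [Matrix.sub_mul, Matrix.smul_mul, Matrix.mul_assoc, Matrix.mul_assoc]
      abel
    rw [e]
    refine hε i j ?_
    rintro rfl
    exact ha i hij
  · have e : S * v * S - S * (v * S - ε • J) = ε • (S * J) := by
      rw [Matrix.mul_sub, Matrix.mul_smul, Matrix.mul_assoc]
      abel
    rw [e, Matrix.smul_apply, smul_eq_mul, Matrix.mul_apply]
    obtain ⟨k, hk⟩ := hS0 i
    refine mul_pos hε0 (Finset.sum_pos' (fun k _ => ?_) ⟨k, Finset.mem_univ k, ?_⟩)
    · simpa [J] using hS i k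
    · simpa [J] using (hS i k).lt_of_ne' hk

lemma GoodPair.of_row [DecidableEq ι] {R : Matrix ι κ ℝ} {S : Matrix κ ι ℝ}
    (hR : ∀ i j, 0 ≤ R i j) (hS : ∀ i j, 0 ≤ S i j) (hS0 : ∀ j, ∃ i, S i j ≠ 0) {a : ι}
    (ha : ∀ j, R a j ≠ 0) (hreach : ∀ b, ∃ p : ℕ, 0 < ((R * S) ^ p) b a) : GoodPair R S := by
  refine GoodPair.of_transpose (GoodPair.of_column (fun i j => hR j i) (fun i j => hS j i) hS0 ha
    fun b => ?_)
  obtain ⟨p, hp⟩ := hreach b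
  exact ⟨p, by rwa [← Matrix.transpose_mul, ← Matrix.transpose_pow]⟩

end Criterion

section Nondeg

variable {ι κ μ : Type*} [Fintype κ]

lemma mul_pos_entry {M : Matrix ι κ ℝ} {N : Matrix κ μ ℝ} (hM : ∀ i j, 0 ≤ M i j)
    (hN : ∀ i j, 0 ≤ N i j) {i : ι} {k : κ} {j : μ} (h1 : M i k ≠ 0) (h2 : N k j ≠ 0) :
    0 < (M * N) i j := by
  rw [Matrix.mul_apply]
  exact Finset.sum_pos' (fun k _ => mul_nonneg (hM _ _) (hN _ _))
    ⟨k, Finset.mem_univ k, mul_pos ((hM i k).lt_of_ne' h1) ((hN k j).lt_of_ne' h2)⟩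

lemma Nondeg.mul {M : Matrix ι κ ℝ} {N : Matrix κ μ ℝ} (hM : ∀ i j, 0 ≤ M i j)
    (hN : ∀ i j, 0 ≤ N i j) (h1 : Nondeg M) (h2 : Nondeg N) : Nondeg (M * N) := by
  refine ⟨fun i => ?_, fun j => ?_⟩
  · obtain ⟨k, hk⟩ := h1.1 i
    obtain ⟨j, hj⟩ := h2.1 k
    exact ⟨j, (mul_pos_entry hM hN hk hj).ne'⟩
  · obtain ⟨k, hk⟩ := h2.2 j
    obtain ⟨i, hi⟩ := h1.2 k
    exact ⟨i, (mul_pos_entry hM hN hi hk).ne'⟩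

lemma AllPos.mul_nondeg {M : Matrix ι κ ℝ} {N : Matrix κ μ ℝ} (hM : AllPos M)
    (hN : ∀ i j, 0 ≤ N i j) (h : Nondeg N) : AllPos (M * N) := fun i j => by
  obtain ⟨k, hk⟩ := h.2 j
  exact mul_pos_entry (fun i j => (hM i j).le) hN (hM i k).ne' hk

lemma AllPos.nondeg_mul {M : Matrix ι κ ℝ} {N : Matrix κ μ ℝ} (hN : AllPos N)
    (hM : ∀ i j, 0 ≤ M i j) (h : Nondeg M) : AllPos (M * N) := fun i j => by
  obtain ⟨k, hk⟩ := h.1 i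
  exact mul_pos_entry hM (fun i j => (hN i j).le) hk (hN k j).ne'

lemma exists_pow_pos [DecidableEq κ] {D : Matrix κ κ ℝ} (hD : ∀ i j, 0 ≤ D i j) {a b : κ}
    (h : Relation.ReflTransGen (fun i j => D i j ≠ 0) a b) : ∃ p : ℕ, 0 < (D ^ p) a b := by
  induction h with
  | refl => exact ⟨0, by simp⟩
  | tail _ hbc ih =>
    obtain ⟨p, hp⟩ := ih
    exact ⟨p + 1, by rw [pow_succ]; exact mul_pos_entry (pow_nonneg_entry hD p) hD hp.ne' hbc⟩

end Nondeg

/-- A sequence of elementary strong shift equivalences between nonnegative matrices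
`C k = R k * S k`, all factors being nondegenerate. -/
structure Ladder where
  J : ℕ → Type
  [fintype : ∀ k, Fintype (J k)]
  [decEq : ∀ k, DecidableEq (J k)]
  [nonempty : ∀ k, Nonempty (J k)]
  R : ∀ k, Matrix (J k) (J (k + 1)) ℝ
  S : ∀ k, Matrix (J (k + 1)) (J k) ℝ
  R_nonneg : ∀ k i j, 0 ≤ R k i j
  S_nonneg : ∀ k i j, 0 ≤ S k i j
  R_nondeg : ∀ k, Nondeg (R k)
  S_nondeg : ∀ k, Nondeg (S k)
  comm : ∀ k, S k * R k = R (k + 1) * S (k + 1)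

namespace Ladder

attribute [instance] Ladder.fintype Ladder.decEq Ladder.nonempty

variable (T : Ladder)

/-- The product `S (a - 1) * ⋯ * S b` for `b ≤ a`, and `0` for `a < b`. -/
def down : ∀ a b, Matrix (T.J a) (T.J b) ℝ
  | 0, b => Matrix.of fun x y => if (⟨0, x⟩ : Σ k, T.J k) = ⟨b, y⟩ then 1 else 0
  | a + 1, b => (Matrix.of fun x y => if (⟨a + 1, x⟩ : Σ k, T.J k) = ⟨b, y⟩ then 1 else 0) +
      T.S a * down a b

lemma down_of_lt {a b : ℕ} (h : a < b) : T.down a b = 0 := by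
  induction a with
  | zero =>
    ext x y
    exact if_neg fun e => h.ne (congrArg Sigma.fst e)
  | succ a ih =>
    rw [down, ih (Nat.lt_of_succ_lt h), Matrix.mul_zero, add_zero]
    ext x y
    exact if_neg fun e => h.ne (congrArg Sigma.fst e)

lemma down_self (a : ℕ) : T.down a a = 1 := by
  cases a with
  | zero =>
    ext x y
    simp [down, Matrix.one_apply]
  | succ a =>
    rw [down, T.down_of_lt a.lt_succ_self, Matrix.mul_zero, add_zero]
    ext x y
    simp [Matrix.one_apply]

lemma down_succ {a b : ℕ} (h : b ≤ a) : T.down (a + 1) b = T.S a * T.down a b := by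
  rw [down, add_eq_right]
  ext x y
  exact if_neg fun e => (Nat.lt_succ_of_le h).ne' (congrArg Sigma.fst e)

lemma down_nonneg (a b : ℕ) : ∀ i j, 0 ≤ T.down a b i j := by
  rcases lt_or_ge a b with h | h
  · intro i j
    rw [T.down_of_lt h, Matrix.zero_apply]
  · induction a, h using Nat.le_induction with
    | base =>
      intro i j
      rw [T.down_self, Matrix.one_apply]
      split_ifs <;> norm_num
    | succ a h ih =>
      rw [T.down_succ h]
      exact mul_nonneg_entry (T.S_nonneg a) ih

lemma down_nondeg {a b : ℕ} (h : b ≤ a) : Nondeg (T.down a b) := by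
  induction a, h using Nat.le_induction with
  | base =>
    rw [T.down_self]
    exact ⟨fun i => ⟨i, by simp⟩, fun i => ⟨i, by simp⟩⟩
  | succ a h ih =>
    rw [T.down_succ h]
    exact Nondeg.mul (T.S_nonneg a) (T.down_nonneg a b) (T.S_nondeg a) ih

lemma down_mul_down {a b c : ℕ} (hab : b ≤ a) (hbc : c ≤ b) :
    T.down a b * T.down b c = T.down a c := by
  induction a, hab using Nat.le_induction with
  | base => rw [T.down_self, Matrix.one_mul]
  | succ a h ih => rw [T.down_succ h, T.down_succ (hbc.trans h), Matrix.mul_assoc, ih]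

lemma down_mul_R {a a' : ℕ} (h : a ≤ a') :
    T.down a' a * T.R a = T.R a' * T.down (a' + 1) (a + 1) := by
  induction a', h using Nat.le_induction with
  | base => rw [T.down_self, T.down_self, Matrix.one_mul, Matrix.mul_one]
  | succ a' h ih =>
    rw [T.down_succ h, T.down_succ (Nat.succ_le_succ h), Matrix.mul_assoc, ih, ← Matrix.mul_assoc,
      ← Matrix.mul_assoc, T.comm]

/-- The product `R a * S a * ⋯ * S b`, where `b ≤ a + 1`. -/
def hop (a b : ℕ) : Matrix (T.J a) (T.J b) ℝ :=
  T.R a * T.down (a + 1) b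

lemma hop_self (a : ℕ) : T.hop a a = T.R a * T.S a := by
  rw [hop, T.down_succ le_rfl, T.down_self, Matrix.mul_one]

lemma hop_nonneg (a b : ℕ) : ∀ i j, 0 ≤ T.hop a b i j :=
  mul_nonneg_entry (T.R_nonneg a) (T.down_nonneg _ b)

lemma hop_nondeg {a b : ℕ} (h : b ≤ a + 1) : Nondeg (T.hop a b) :=
  Nondeg.mul (T.R_nonneg a) (T.down_nonneg _ b) (T.R_nondeg a) (T.down_nondeg h)

lemma hop_mul_down {a b c : ℕ} (hab : b ≤ a + 1) (hbc : c ≤ b) :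
    T.hop a b * T.down b c = T.hop a c := by
  rw [hop, Matrix.mul_assoc, T.down_mul_down hab hbc, hop]

lemma down_mul_hop {a a' b : ℕ} (haa : a ≤ a') (hab : b ≤ a + 1) :
    T.down a' a * T.hop a b = T.hop a' b := by
  rw [hop, ← Matrix.mul_assoc, T.down_mul_R haa, Matrix.mul_assoc,
    T.down_mul_down (Nat.succ_le_succ haa) hab, hop]

lemma allPos_hop_left {b : ℕ} (h : AllPos (T.hop b b)) {a : ℕ} (hab : b ≤ a) :
    AllPos (T.hop a b) := by
  rw [← T.down_mul_hop hab b.le_succ]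
  exact h.nondeg_mul (T.down_nonneg _ _) (T.down_nondeg hab)

lemma allPos_hop_right {a : ℕ} (h : AllPos (T.hop a a)) {b : ℕ} (hab : b ≤ a) :
    AllPos (T.hop a b) := by
  rw [← T.hop_mul_down a.le_succ hab]
  exact h.mul_nondeg (T.down_nonneg _ _) (T.down_nondeg hab)

section Block

variable {K K' : Type}

/-- The block matrix with blocks `ξ k i • hop (w k) (w' i)`. -/
def upBlock (ξ : K → K' → ℝ) (w : K → ℕ) (w' : K' → ℕ) :
    Matrix (Σ k, T.J (w k)) (Σ i, T.J (w' i)) ℝ :=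
  Matrix.of fun p q => ξ p.1 q.1 * T.hop (w p.1) (w' q.1) p.2 q.2

/-- The block matrix with blocks `down (w' i) (w (f i))`. -/
def downBlock [DecidableEq K] (f : K' → K) (w' : K' → ℕ) (w : K → ℕ) :
    Matrix (Σ i, T.J (w' i)) (Σ k, T.J (w k)) ℝ :=
  Matrix.of fun q p => if f q.1 = p.1 then T.down (w' q.1) (w p.1) q.2 p.2 else 0

lemma upBlock_nonneg {ξ : K → K' → ℝ} (hξ : ∀ k i, 0 ≤ ξ k i) (w : K → ℕ) (w' : K' → ℕ) :
    ∀ p q, 0 ≤ T.upBlock ξ w w' p q := fun _ _ =>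
  mul_nonneg (hξ _ _) (T.hop_nonneg _ _ _ _)

lemma downBlock_nonneg [DecidableEq K] (f : K' → K) (w' : K' → ℕ) (w : K → ℕ) :
    ∀ q p, 0 ≤ T.downBlock f w' w q p := fun q p => by
  simp only [downBlock, Matrix.of_apply]
  split_ifs
  · exact T.down_nonneg _ _ _ _
  · exact le_rfl

lemma downBlock_nondeg [DecidableEq K] {f : K' → K} (hf : Function.Surjective f) {w' : K' → ℕ}
    {w : K → ℕ} (hw : ∀ i, w (f i) ≤ w' i) : Nondeg (T.downBlock f w' w) := by
  refine ⟨fun ⟨i, x⟩ => ?_, fun ⟨k, y⟩ => ?_⟩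
  · obtain ⟨y, hy⟩ := (T.down_nondeg (hw i)).1 x
    exact ⟨⟨f i, y⟩, by simpa [downBlock] using hy⟩
  · obtain ⟨i, rfl⟩ := hf k
    obtain ⟨x, hx⟩ := (T.down_nondeg (hw i)).2 y
    exact ⟨⟨i, x⟩, by simpa [downBlock] using hx⟩

variable [DecidableEq K]

lemma upBlock_mul_downBlock [Fintype K'] {ξ : K → K' → ℝ} {f : K' → K} {w : K → ℕ} {w' : K' → ℕ}
    (hw : ∀ i, w (f i) ≤ w' i) (hw' : ∀ k i, ξ k i ≠ 0 → w' i ≤ w k + 1) :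
    T.upBlock ξ w w' * T.downBlock f w' w =
      T.upBlock (fun k j => ∑ i, if f i = j then ξ k i else 0) w w := by
  ext ⟨k, x⟩ ⟨j, z⟩
  simp only [upBlock, downBlock, Matrix.mul_apply, Matrix.of_apply, Fintype.sum_sigma,
    Finset.sum_mul]
  refine Finset.sum_congr rfl fun i _ => ?_
  split_ifs with h
  · subst h
    rcases eq_or_ne (ξ k i) 0 with h0 | h0
    · simp [h0]
    · rw [← T.hop_mul_down (hw' k i h0) (hw i), Matrix.mul_apply, Finset.mul_sum]
      exact Finset.sum_congr rfl fun y _ => mul_assoc _ _ _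
  · simp

lemma downBlock_mul_upBlock [Fintype K] {ξ : K → K' → ℝ} {f : K' → K} {w : K → ℕ} {w' : K' → ℕ}
    (hw : ∀ i, w (f i) ≤ w' i) (hw' : ∀ k i, ξ k i ≠ 0 → w' i ≤ w k + 1) :
    T.downBlock f w' w * T.upBlock ξ w w' = T.upBlock (fun i j => ξ (f i) j) w' w' := by
  ext ⟨i, x⟩ ⟨j, z⟩
  simp only [upBlock, downBlock, Matrix.mul_apply, Matrix.of_apply, Fintype.sum_sigma]
  rw [Finset.sum_eq_single (f i) (fun k _ hk => by simp [hk.symm]) (by simp)]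
  rcases eq_or_ne (ξ (f i) j) 0 with h0 | h0
  · simp [h0]
  · rw [← T.down_mul_hop (hw i) (hw' _ j h0), Matrix.mul_apply, Finset.mul_sum]
    refine Finset.sum_congr rfl fun y _ => ?_
    rw [if_pos rfl]
    ring

end Block

end Ladder

namespace Ladder

variable (T : Ladder) {n : ℕ}

lemma reflTransGen_zero_upBlock {π : Fin (n + 1) → Fin (n + 1) → ℝ} {w : Fin (n + 1) → ℕ}
    (h0 : π 0 0 ≠ 0) (hsucc : ∀ i : Fin n, π i.castSucc i.succ ≠ 0)
    (hw : ∀ i : Fin n, w i.succ ≤ w i.castSucc + 1) (hpos : AllPos (T.hop (w 0) (w 0)))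
    (y₀ : T.J (w 0)) (q : Σ i, T.J (w i)) :
    Relation.ReflTransGen (fun p q => T.upBlock π w w p q ≠ 0) ⟨0, y₀⟩ q := by
  obtain ⟨j, z⟩ := q
  induction j using Fin.induction with
  | zero => exact .single (mul_ne_zero h0 (hpos y₀ z).ne')
  | succ i ih =>
    obtain ⟨y, hy⟩ := (T.hop_nondeg (hw i)).2 z
    exact (ih y).tail (mul_ne_zero (hsucc i) hy)

lemma reflTransGen_upBlock_last {π : Fin (n + 1) → Fin (n + 1) → ℝ} {w : Fin (n + 1) → ℕ}
    (h0 : π (Fin.last n) (Fin.last n) ≠ 0) (hsucc : ∀ i : Fin n, π i.castSucc i.succ ≠ 0)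
    (hw : ∀ i : Fin n, w i.succ ≤ w i.castSucc + 1)
    (hpos : AllPos (T.hop (w (Fin.last n)) (w (Fin.last n)))) (y₀ : T.J (w (Fin.last n)))
    (q : Σ i, T.J (w i)) :
    Relation.ReflTransGen (fun p q => T.upBlock π w w p q ≠ 0) q ⟨Fin.last n, y₀⟩ := by
  obtain ⟨j, z⟩ := q
  induction j using Fin.reverseInduction with
  | last => exact .single (mul_ne_zero h0 (hpos z y₀).ne')
  | cast i ih =>
    obtain ⟨y, hy⟩ := (T.hop_nondeg (hw i)).1 z
    have h : T.upBlock π w w ⟨i.castSucc, z⟩ ⟨i.succ, y⟩ ≠ 0 := mul_ne_zero (hsucc i) hy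
    exact .head h (ih y)

instance (w : Fin (n + 1) → ℕ) : Nonempty (Σ i, T.J (w i)) :=
  ⟨0, Classical.arbitrary _⟩

variable {U : Subfield ℝ} {p₀ : (n : ℕ) × Matrix (Fin n) (Fin n) ℝ}

/-- The transition probabilities of a walk on `ℕ`, truncated at `c`. -/
noncomputable def weight (c j : ℕ) : ℝ :=
  if j < c then (1 / 2) ^ (j + 1) else if j = c then (1 / 2) ^ c else 0

lemma weight_nonneg (c j : ℕ) : 0 ≤ weight c j := by
  unfold weight
  split_ifs <;> positivity

lemma weight_ne_zero_iff {c j : ℕ} : weight c j ≠ 0 ↔ j ≤ c := by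
  unfold weight
  split_ifs with h1 h2
  · exact iff_of_true (by positivity) h1.le
  · exact iff_of_true (by positivity) h2.le
  · exact iff_of_false (by simp) (by omega)

/-- The transition matrix of the walk on `{0, …, n}`. -/
noncomputable def walk (n : ℕ) (i j : Fin (n + 1)) : ℝ :=
  weight (min (i + 1) n) j

lemma walk_nonneg (i j : Fin (n + 1)) : 0 ≤ walk n i j := weight_nonneg _ _

lemma walk_ne_zero_iff {i j : Fin (n + 1)} : walk n i j ≠ 0 ↔ (j : ℕ) ≤ i + 1 := by
  rw [walk, weight_ne_zero_iff]
  omega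

lemma walk_castSucc_succ (i : Fin n) : walk n i.castSucc i.succ ≠ 0 :=
  walk_ne_zero_iff.2 (by simp)

/-- The block matrix of the walk, with blocks of level `w i`. -/
noncomputable def block (w : Fin (n + 1) → ℕ) : Matrix (Σ i, T.J (w i)) (Σ i, T.J (w i)) ℝ :=
  T.upBlock (walk n) w w

lemma reachLim_block_succ_iff {c : ℕ} (hc : AllPos (T.hop c c)) :
    ReachLim U p₀ (T.block fun _ : Fin (n + 1) => c) ↔
      ReachLim U p₀ (T.block fun _ : Fin (n + 2) => c) := by
  let f : Fin (n + 2) → Fin (n + 1) := fun i => ⟨min i n, by omega⟩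
  let ξ : Fin (n + 1) → Fin (n + 2) → ℝ := fun k i => weight (k + 1) i
  have hf : Function.Surjective f := fun k => ⟨k.castSucc, Fin.ext (by simp [f]; omega)⟩
  have hξ : ∀ k i, 0 ≤ ξ k i := fun k i => weight_nonneg _ _
  have hw : ∀ i, (fun _ : Fin (n + 1) => c) (f i) ≤ (fun _ : Fin (n + 2) => c) i := fun _ => le_rfl
  have hw' : ∀ k i, ξ k i ≠ 0 → (fun _ : Fin (n + 2) => c) i ≤ (fun _ : Fin (n + 1) => c) k + 1 :=
    fun _ _ _ => c.le_succ
  have e1 : (fun k j => ∑ i, if f i = j then ξ k i else 0) = walk n := by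
    ext k j
    rw [Fin.sum_univ_castSucc]
    have h1 : ∀ i : Fin (n + 1), f i.castSucc = i := fun i => Fin.ext (by simp [f]; omega)
    have h2 : f (Fin.last (n + 1)) = Fin.last n := Fin.ext (by simp [f])
    simp only [h1, h2, Finset.sum_ite_eq', Finset.mem_univ, if_true, ξ, walk, Fin.val_castSucc,
      Fin.val_last]
    have hk := k.2
    rcases (Nat.le_of_lt_succ j.2).lt_or_eq with hj | hj
    · rw [if_neg fun h => hj.ne (congrArg Fin.val h).symm, add_zero]
      rcases (Nat.le_of_lt_succ hk).lt_or_eq with h | h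
      · rw [min_eq_left h]
      · rw [h, min_eq_right n.le_succ, weight, weight, if_pos hj, if_pos (by omega)]
    · rw [if_pos (Fin.ext hj.symm), hj]
      rcases (Nat.le_of_lt_succ hk).lt_or_eq with h | h
      · rw [min_eq_left h,
          not_not.1 (mt (weight_ne_zero_iff (c := k + 1) (j := n + 1)).1 (by omega)),
          add_zero]
      · rw [h, min_eq_right n.le_succ]
        simp only [weight, lt_irrefl, if_true, if_false, Nat.lt_succ_self]
        ring
  have e2 : (fun i j => ξ (f i) j) = walk (n + 1) := by
    ext i j
    simp only [ξ, f, walk]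
    congr 1
    omega
  have good : GoodPair (T.upBlock ξ (fun _ => c) fun _ => c)
      (T.downBlock f (fun _ => c) fun _ => c) := by
    obtain ⟨y₀⟩ := T.nonempty c
    refine GoodPair.of_column (T.upBlock_nonneg hξ _ _) (T.downBlock_nonneg f _ _)
      (T.downBlock_nondeg hf hw).1 (a := ⟨0, y₀⟩)
      (fun p => mul_ne_zero (weight_ne_zero_iff.2 (Nat.zero_le _)) (hc _ _).ne') fun b => ?_
    refine exists_pow_pos (mul_nonneg_entry (T.downBlock_nonneg f _ _) (T.upBlock_nonneg hξ _ _)) ?_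
    rw [T.downBlock_mul_upBlock hw hw', e2]
    exact T.reflTransGen_zero_upBlock (walk_ne_zero_iff.2 (Nat.zero_le _)) walk_castSucc_succ
      (fun _ => c.le_succ) hc y₀ b
  have := good.reachLim_iff (U := U) (p₀ := p₀) (T.upBlock_nonneg hξ _ _)
    (T.downBlock_nonneg f _ _) (T.downBlock_nondeg hf hw)
  rwa [T.upBlock_mul_downBlock hw hw', T.downBlock_mul_upBlock hw hw', e1, e2] at this

/-- The level of block `j` at time `τ`. -/
def level (l τ j : ℕ) : ℕ := min l ((τ + j) / 2 - l)

lemma reachLim_block_level_iff {l : ℕ} (h0 : AllPos (T.hop 0 0)) (hl : AllPos (T.hop l l))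
    (τ : ℕ) :
    ReachLim U p₀ (T.block fun j : Fin (2 * l + 1) => level l τ j) ↔
      ReachLim U p₀ (T.block fun j : Fin (2 * l + 1) => level l (τ + 1) j) := by
  let w : ℕ → Fin (2 * l + 1) → ℕ := fun τ j => level l τ j
  have hw : ∀ i, w τ (id i) ≤ w (τ + 1) i := fun i => by
    simp only [w, level, id]
    omega
  have hw' : ∀ k i, walk (2 * l) k i ≠ 0 → w (τ + 1) i ≤ w τ k + 1 := fun k i h => by
    rw [walk_ne_zero_iff] at h
    simp only [w, level]
    omega
  have hsucc : ∀ σ, ∀ i : Fin (2 * l), w σ i.succ ≤ w σ i.castSucc + 1 := fun σ i => by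
    simp only [w, level, Fin.val_succ, Fin.val_castSucc]
    omega
  have e1 : (fun k j => ∑ i, if id i = j then walk (2 * l) k i else 0) = walk (2 * l) := by
    ext k j
    simp
  have nd := T.downBlock_nondeg Function.surjective_id hw
  have up0 := T.upBlock_nonneg (walk_nonneg (n := 2 * l)) (w τ) (w (τ + 1))
  have dn0 := T.downBlock_nonneg id (w (τ + 1)) (w τ)
  have good : GoodPair (T.upBlock (walk (2 * l)) (w τ) (w (τ + 1)))
      (T.downBlock id (w (τ + 1)) (w τ)) := by
    rcases le_or_gt τ (2 * l) with hτ | hτ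
    · have hz : w (τ + 1) 0 = 0 := by
        simp only [w, level, Fin.val_zero]
        omega
      have hpos : ∀ a, AllPos (T.hop a (w (τ + 1) 0)) := fun a => by
        rw [hz]
        exact T.allPos_hop_left h0 a.zero_le
      obtain ⟨y₀⟩ := T.nonempty (w (τ + 1) 0)
      refine GoodPair.of_column up0 dn0 nd.1 (a := ⟨0, y₀⟩)
        (fun p => mul_ne_zero (walk_ne_zero_iff.2 (Nat.zero_le _)) (hpos _ _ _).ne') fun b => ?_
      refine exists_pow_pos (mul_nonneg_entry dn0 up0) ?_
      rw [T.downBlock_mul_upBlock hw hw']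
      exact T.reflTransGen_zero_upBlock (walk_ne_zero_iff.2 (Nat.zero_le _)) walk_castSucc_succ
        (hsucc _) (hpos _) y₀ b
    · have hz : w τ (Fin.last _) = l := by
        simp only [w, level, Fin.val_last]
        omega
      have hpos : ∀ b, b ≤ l → AllPos (T.hop (w τ (Fin.last _)) b) := fun b hb => by
        rw [hz]
        exact T.allPos_hop_right hl hb
      have hle : ∀ σ i, w σ i ≤ l := fun σ i => min_le_left _ _
      obtain ⟨y₀⟩ := T.nonempty (w τ (Fin.last _))
      refine GoodPair.of_row up0 dn0 nd.2 (a := ⟨Fin.last _, y₀⟩)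
        (fun p => mul_ne_zero (walk_ne_zero_iff.2 (by simp only [Fin.val_last]; omega))
          (hpos _ (hle _ _) _ _).ne') fun b => ?_
      refine exists_pow_pos (mul_nonneg_entry up0 dn0) ?_
      rw [T.upBlock_mul_downBlock hw hw', e1]
      exact T.reflTransGen_upBlock_last (walk_ne_zero_iff.2 (Nat.le_succ _)) walk_castSucc_succ
        (hsucc _) (hpos _ (hle _ _)) y₀ b
  have := good.reachLim_iff (U := U) (p₀ := p₀) up0 dn0 nd
  rwa [T.upBlock_mul_downBlock hw hw', T.downBlock_mul_upBlock hw hw', e1] at this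

lemma reachLim_block_zero_iff {l : ℕ} (h0 : AllPos (T.hop 0 0)) (hl : AllPos (T.hop l l)) :
    ReachLim U p₀ (T.block fun _ : Fin 1 => 0) ↔ ReachLim U p₀ (T.block fun _ : Fin 1 => l) := by
  have dup : ∀ {c : ℕ}, AllPos (T.hop c c) → ∀ n,
      (ReachLim U p₀ (T.block fun _ : Fin 1 => c) ↔
        ReachLim U p₀ (T.block fun _ : Fin (n + 1) => c)) := fun hc n => by
    induction n with
    | zero => exact Iff.rfl
    | succ n ih => exact ih.trans (T.reachLim_block_succ_iff hc)
  have time : ∀ τ, (ReachLim U p₀ (T.block fun j : Fin (2 * l + 1) => level l 0 j) ↔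
      ReachLim U p₀ (T.block fun j : Fin (2 * l + 1) => level l τ j)) := fun τ => by
    induction τ with
    | zero => exact Iff.rfl
    | succ τ ih => exact ih.trans (T.reachLim_block_level_iff h0 hl τ)
  have cast : ∀ {w w' : Fin (2 * l + 1) → ℕ}, w = w' →
      (ReachLim U p₀ (T.block w) ↔ ReachLim U p₀ (T.block w')) := fun h => h ▸ Iff.rfl
  have e0 : (fun _ => 0) = fun j : Fin (2 * l + 1) => level l 0 j := funext fun j => by
    simp only [level]
    omega
  have e1 : (fun j : Fin (2 * l + 1) => level l (4 * l) j) = fun _ => l := funext fun j => by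
    simp only [level]
    omega
  exact (dup h0 (2 * l)).trans
    ((cast e0).trans ((time (4 * l)).trans ((cast e1).trans (dup hl (2 * l)).symm)))

end Ladder

section Trim

variable {X : ℕ → Type} [∀ i, Fintype (X i)] [DecidableEq (X 0)]

/-- The product `R 0 * ⋯ * R (i - 1)`. -/
def prodUp (R : ∀ i, Matrix (X i) (X (i + 1)) ℝ) : ∀ i, Matrix (X 0) (X i) ℝ
  | 0 => 1
  | i + 1 => prodUp R i * R i

/-- The product `S (i - 1) * ⋯ * S 0`. -/
def prodDown (S : ∀ i, Matrix (X (i + 1)) (X i) ℝ) : ∀ i, Matrix (X i) (X 0) ℝ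
  | 0 => 1
  | i + 1 => S i * prodDown S i

variable {R : ∀ i, Matrix (X i) (X (i + 1)) ℝ} {S : ∀ i, Matrix (X (i + 1)) (X i) ℝ}

lemma prodUp_nonneg (hR : ∀ i x y, 0 ≤ R i x y) (i : ℕ) : ∀ x y, 0 ≤ prodUp R i x y := by
  induction i with
  | zero =>
    intro x y
    rw [prodUp, Matrix.one_apply]
    split_ifs <;> norm_num
  | succ i ih => exact mul_nonneg_entry ih (hR i)

lemma prodDown_nonneg (hS : ∀ i x y, 0 ≤ S i x y) (i : ℕ) : ∀ x y, 0 ≤ prodDown S i x y := by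
  induction i with
  | zero =>
    intro x y
    rw [prodDown, Matrix.one_apply]
    split_ifs <;> norm_num
  | succ i ih => exact mul_nonneg_entry (hS i) ih

lemma prodUp_mul (comm : ∀ i, S i * R i = R (i + 1) * S (i + 1)) (i : ℕ) :
    prodUp R i * (R i * S i) = R 0 * S 0 * prodUp R i := by
  induction i with
  | zero => rw [prodUp, Matrix.one_mul, Matrix.mul_one]
  | succ i ih =>
    rw [prodUp, ← comm, ← Matrix.mul_assoc (R 0 * S 0), ← ih]
    simp only [Matrix.mul_assoc]

lemma mul_prodDown (comm : ∀ i, S i * R i = R (i + 1) * S (i + 1)) (i : ℕ) :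
    R i * S i * prodDown S i = prodDown S i * (R 0 * S 0) := by
  induction i with
  | zero => rw [prodDown, Matrix.one_mul, Matrix.mul_one]
  | succ i ih =>
    rw [prodDown, ← comm, Matrix.mul_assoc (S i) (prodDown S i), ← ih]
    simp only [Matrix.mul_assoc]

/-- The indices met by a path of nonzero entries which starts and ends in `X 0`. -/
def Trimmed (R : ∀ i, Matrix (X i) (X (i + 1)) ℝ) (S : ∀ i, Matrix (X (i + 1)) (X i) ℝ) (i : ℕ)
    (x : X i) : Prop :=
  (∃ a, prodUp R i a x ≠ 0) ∧ ∃ a, prodDown S i x a ≠ 0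

lemma exists_prodUp_ne_zero (hR : ∀ i x y, 0 ≤ R i x y) (hS : ∀ i x y, 0 ≤ S i x y)
    (comm : ∀ i, S i * R i = R (i + 1) * S (i + 1)) {i : ℕ} {x y : X i}
    (hx : ∃ a, prodUp R i a x ≠ 0) (hxy : (R i * S i) x y ≠ 0) : ∃ a, prodUp R i a y ≠ 0 := by
  obtain ⟨a, ha⟩ := hx
  have h := mul_pos_entry (prodUp_nonneg hR i) (mul_nonneg_entry (hR i) (hS i)) ha hxy
  rw [prodUp_mul comm, Matrix.mul_apply] at h
  by_contra! hc
  simp [hc] at h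

lemma exists_prodDown_ne_zero (hR : ∀ i x y, 0 ≤ R i x y) (hS : ∀ i x y, 0 ≤ S i x y)
    (comm : ∀ i, S i * R i = R (i + 1) * S (i + 1)) {i : ℕ} {x y : X i}
    (hy : ∃ a, prodDown S i y a ≠ 0) (hxy : (R i * S i) x y ≠ 0) :
    ∃ a, prodDown S i x a ≠ 0 := by
  obtain ⟨a, ha⟩ := hy
  have h := mul_pos_entry (mul_nonneg_entry (hR i) (hS i)) (prodDown_nonneg hS i) hxy ha
  rw [mul_prodDown comm, Matrix.mul_apply] at h
  by_contra! hc
  simp [hc] at h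

lemma sum_subtype_mul {α β γ : Type*} [Fintype β] {P : β → Prop} [Fintype {x // P x}]
    {M : Matrix α β ℝ} {N : Matrix β γ ℝ} {i : α} {j : γ}
    (h : ∀ x, M i x ≠ 0 → N x j ≠ 0 → P x) :
    ∑ x : {x // P x}, M i x * N x j = (M * N) i j := by
  rw [Matrix.mul_apply]
  refine Fintype.sum_of_injective Subtype.val Subtype.val_injective _ _ (fun x hx => ?_)
    fun _ => rfl
  by_contra hc
  exact hx ⟨⟨x, h x (left_ne_zero_of_mul hc) (right_ne_zero_of_mul hc)⟩, rfl⟩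

variable (R S) in
/-- The restriction of `R i` to the trimmed indices. -/
def trimUp (i : ℕ) : Matrix {x // Trimmed R S i x} {x // Trimmed R S (i + 1) x} ℝ :=
  (R i).submatrix Subtype.val Subtype.val

variable (R S) in
/-- The restriction of `S i` to the trimmed indices. -/
def trimDown (i : ℕ) : Matrix {x // Trimmed R S (i + 1) x} {x // Trimmed R S i x} ℝ :=
  (S i).submatrix Subtype.val Subtype.val

variable (R S) in
/-- The restriction of `R i * S i` to the trimmed indices. -/
def trimSq (i : ℕ) : Matrix {x // Trimmed R S i x} {x // Trimmed R S i x} ℝ :=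
  (R i * S i).submatrix Subtype.val Subtype.val

lemma trimUp_mul_trimDown (hR : ∀ i x y, 0 ≤ R i x y) (hS : ∀ i x y, 0 ≤ S i x y) (i : ℕ)
    [Fintype {x // Trimmed R S (i + 1) x}] : trimUp R S i * trimDown R S i = trimSq R S i := by
  ext x y
  rw [Matrix.mul_apply]
  refine sum_subtype_mul (P := Trimmed R S (i + 1)) fun u h1 h2 => ?_
  obtain ⟨a, ha⟩ := x.2.1
  obtain ⟨b, hb⟩ := y.2.2
  exact ⟨⟨a, (mul_pos_entry (prodUp_nonneg hR i) (hR i) ha h1).ne'⟩,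
    b, (mul_pos_entry (hS i) (prodDown_nonneg hS i) h2 hb).ne'⟩

lemma trimDown_mul_trimUp (hR : ∀ i x y, 0 ≤ R i x y) (hS : ∀ i x y, 0 ≤ S i x y)
    (comm : ∀ i, S i * R i = R (i + 1) * S (i + 1)) (i : ℕ)
    [Fintype {x // Trimmed R S i x}] :
    trimDown R S i * trimUp R S i = trimSq R S (i + 1) := by
  ext x y
  rw [Matrix.mul_apply, trimSq, Matrix.submatrix_apply, ← comm]
  refine sum_subtype_mul (P := Trimmed R S i) fun u h1 h2 => ?_
  obtain ⟨a, ha⟩ := x.2.1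
  obtain ⟨b, hb⟩ := y.2.2
  constructor
  · rw [prodUp, Matrix.mul_apply] at ha
    obtain ⟨v, -, hv⟩ := Finset.exists_ne_zero_of_sum_ne_zero ha
    exact exists_prodUp_ne_zero hR hS comm ⟨a, left_ne_zero_of_mul hv⟩
      (mul_pos_entry (hR i) (hS i) (right_ne_zero_of_mul hv) h1).ne'
  · rw [prodDown, Matrix.mul_apply] at hb
    obtain ⟨v, -, hv⟩ := Finset.exists_ne_zero_of_sum_ne_zero hb
    exact exists_prodDown_ne_zero hR hS comm ⟨b, right_ne_zero_of_mul hv⟩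
      (mul_pos_entry (hR i) (hS i) h2 (left_ne_zero_of_mul hv)).ne'

lemma nondeg_trimSq (hR : ∀ i x y, 0 ≤ R i x y) (hS : ∀ i x y, 0 ≤ S i x y)
    (comm : ∀ i, S i * R i = R (i + 1) * S (i + 1)) (hA : AllPos (R 0 * S 0)) (i : ℕ) :
    Nondeg (trimSq R S i) := by
  have hA0 : ∀ x y, 0 ≤ (R 0 * S 0) x y := fun x y => (hA x y).le
  refine ⟨fun ⟨x, hx⟩ => ?_, fun ⟨x, hx⟩ => ?_⟩
  · obtain ⟨a, ha⟩ := hx.2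
    have h := (mul_pos_entry (prodDown_nonneg hS i) hA0 ha (hA a a).ne').ne'
    rw [← mul_prodDown comm, Matrix.mul_apply] at h
    obtain ⟨v, -, hv⟩ := Finset.exists_ne_zero_of_sum_ne_zero h
    exact ⟨⟨v, exists_prodUp_ne_zero hR hS comm hx.1 (left_ne_zero_of_mul hv), a,
      right_ne_zero_of_mul hv⟩, left_ne_zero_of_mul hv⟩
  · obtain ⟨a, ha⟩ := hx.1
    have h := (mul_pos_entry hA0 (prodUp_nonneg hR i) (hA a a).ne' ha).ne'
    rw [← prodUp_mul comm, Matrix.mul_apply] at h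
    obtain ⟨v, -, hv⟩ := Finset.exists_ne_zero_of_sum_ne_zero h
    exact ⟨⟨v, ⟨a, left_ne_zero_of_mul hv⟩,
      exists_prodDown_ne_zero hR hS comm hx.2 (right_ne_zero_of_mul hv)⟩, right_ne_zero_of_mul hv⟩

lemma Nondeg.of_mul {ι κ : Type*} [Fintype ι] [Fintype κ] {M : Matrix ι κ ℝ}
    {N : Matrix κ ι ℝ} (h1 : Nondeg (M * N)) (h2 : Nondeg (N * M)) : Nondeg M := by
  refine ⟨fun i => ?_, fun j => ?_⟩
  · obtain ⟨j, hj⟩ := h1.1 i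
    rw [Matrix.mul_apply] at hj
    obtain ⟨v, -, hv⟩ := Finset.exists_ne_zero_of_sum_ne_zero hj
    exact ⟨v, left_ne_zero_of_mul hv⟩
  · obtain ⟨i, hi⟩ := h2.2 j
    rw [Matrix.mul_apply] at hi
    obtain ⟨v, -, hv⟩ := Finset.exists_ne_zero_of_sum_ne_zero hi
    exact ⟨v, right_ne_zero_of_mul hv⟩

lemma nonempty_trimmed [Nonempty (X 0)] (hR : ∀ i x y, 0 ≤ R i x y)
    (hS : ∀ i x y, 0 ≤ S i x y) (comm : ∀ i, S i * R i = R (i + 1) * S (i + 1))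
    (hA : AllPos (R 0 * S 0)) (i : ℕ) : Nonempty {x // Trimmed R S i x} := by
  induction i with
  | zero =>
    obtain ⟨a⟩ := ‹Nonempty (X 0)›
    exact ⟨a, ⟨a, by simp [prodUp]⟩, a, by simp [prodDown]⟩
  | succ i ih =>
    classical
    obtain ⟨x⟩ := ih
    obtain ⟨y, hy⟩ := (nondeg_trimSq hR hS comm hA i).1 x
    rw [← trimUp_mul_trimDown hR hS, Matrix.mul_apply] at hy
    obtain ⟨v, -⟩ := Finset.exists_ne_zero_of_sum_ne_zero hy
    exact ⟨v⟩

open Classical in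
/-- The ladder of the trimmed matrices. -/
noncomputable def Ladder.trim [Nonempty (X 0)] (hR : ∀ i x y, 0 ≤ R i x y)
    (hS : ∀ i x y, 0 ≤ S i x y) (comm : ∀ i, S i * R i = R (i + 1) * S (i + 1))
    (hA : AllPos (R 0 * S 0)) : Ladder :=
  have h1 := trimUp_mul_trimDown hR hS
  have h2 := trimDown_mul_trimUp hR hS comm
  have nd := nondeg_trimSq hR hS comm hA
  { J := fun i => {x // Trimmed R S i x}
    nonempty := nonempty_trimmed hR hS comm hA
    R := trimUp R S
    S := trimDown R S
    R_nonneg := fun i _ _ => hR i _ _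
    S_nonneg := fun i _ _ => hS i _ _
    R_nondeg := fun i => Nondeg.of_mul (by rw [h1]; exact nd i) (by rw [h2]; exact nd (i + 1))
    S_nondeg := fun i => Nondeg.of_mul (by rw [h2]; exact nd (i + 1)) (by rw [h1]; exact nd i)
    comm := fun i => (h2 i).trans (h1 (i + 1)).symm }

lemma Ladder.trim_hop [Nonempty (X 0)] (hR : ∀ i x y, 0 ≤ R i x y)
    (hS : ∀ i x y, 0 ≤ S i x y) (comm : ∀ i, S i * R i = R (i + 1) * S (i + 1))
    (hA : AllPos (R 0 * S 0)) (i : ℕ) :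
    (Ladder.trim hR hS comm hA).hop i i = trimSq R S i := by
  classical
  rw [Ladder.hop_self]
  exact trimUp_mul_trimDown hR hS i

end Trim

lemma prodDown_mul_prodUp {X : ℕ → Type} [∀ i, Fintype (X i)] [∀ i, DecidableEq (X i)]
    {R : ∀ i, Matrix (X i) (X (i + 1)) ℝ} {S : ∀ i, Matrix (X (i + 1)) (X i) ℝ}
    (comm : ∀ i, S i * R i = R (i + 1) * S (i + 1)) (i : ℕ) :
    (prodDown S i * prodUp R i : Matrix (X i) (X i) ℝ) = (R i * S i) ^ i := by
  induction i with
  | zero => simp [prodDown, prodUp]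
  | succ i ih =>
    rw [← comm, mul_pow_comm_mul, ← ih, prodDown, prodUp]
    simp only [Matrix.mul_assoc]

lemma trimmed_of_allPos {X : ℕ → Type} [∀ i, Fintype (X i)] [∀ i, DecidableEq (X i)]
    {R : ∀ i, Matrix (X i) (X (i + 1)) ℝ} {S : ∀ i, Matrix (X (i + 1)) (X i) ℝ}
    (comm : ∀ i, S i * R i = R (i + 1) * S (i + 1)) {i : ℕ} (h : AllPos (R i * S i)) (x : X i) :
    Trimmed R S i x := by
  have hp : ∀ q : ℕ, 0 < ((R i * S i) ^ q) x x := fun q => by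
    have h0 : ∀ x y, 0 ≤ (R i * S i) x y := fun x y => (h x y).le
    induction q with
    | zero => simp
    | succ q ih =>
      rw [pow_succ]
      exact mul_pos_entry (pow_nonneg_entry h0 q) h0 ih.ne' (h x x).ne'
  have h1 := (hp i).ne'
  rw [← prodDown_mul_prodUp comm, Matrix.mul_apply] at h1
  obtain ⟨a, -, ha⟩ := Finset.exists_ne_zero_of_sum_ne_zero h1
  exact ⟨⟨a, right_ne_zero_of_mul ha⟩, a, left_ne_zero_of_mul ha⟩

/-- A single block at level `c`. -/
def Ladder.sigmaEquiv (T : Ladder) (c : ℕ) : (Σ _ : Fin 1, T.J c) ≃ T.J c where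
  toFun := Sigma.snd
  invFun x := ⟨0, x⟩
  left_inv := fun ⟨i, x⟩ => by rw [Subsingleton.elim i 0]
  right_inv _ := rfl

lemma Ladder.reflTransGen_posStep (T : Ladder) {U : Subfield ℝ} {m k l : ℕ}
    {A : Matrix (Fin m) (Fin m) ℝ} {B : Matrix (Fin k) (Fin k) ℝ}
    (hAU : entriesIn (U : Set ℝ) A) (hBU : entriesIn (U : Set ℝ) B) (hA : PosEntries A)
    (hB : PosEntries B) (e : T.J 0 ≃ Fin m) (f : T.J l ≃ Fin k)
    (he : T.hop 0 0 = A.submatrix e e) (hf : T.hop l l = B.submatrix f f) :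
    Relation.ReflTransGen (PosStep U) ⟨m, A⟩ ⟨k, B⟩ := by
  have block_eq : ∀ {n c : ℕ} {M : Matrix (Fin n) (Fin n) ℝ} (g : T.J c ≃ Fin n),
      T.hop c c = M.submatrix g g → (T.block fun _ : Fin 1 => c) =
        M.submatrix ((T.sigmaEquiv c).trans g) ((T.sigmaEquiv c).trans g) := fun g hg => by
    ext ⟨i, x⟩ ⟨j, y⟩
    have hw : Ladder.walk 0 i j = 1 := by simp [Ladder.walk, Ladder.weight]
    rw [Ladder.block, Ladder.upBlock, Matrix.of_apply, hw, one_mul, hg]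
    rfl
  have iff := T.reachLim_block_zero_iff (U := U) (p₀ := ⟨m, A⟩) (he ▸ fun _ _ => hA _ _)
    (hf ▸ fun _ _ => hB _ _ : AllPos (T.hop l l))
  rw [block_eq e he, block_eq f hf] at iff
  have hA' : AllPos (A.submatrix ((T.sigmaEquiv 0).trans e) ((T.sigmaEquiv 0).trans e)) :=
    fun _ _ => hA _ _
  have hAU' : OverField U (A.submatrix ((T.sigmaEquiv 0).trans e) ((T.sigmaEquiv 0).trans e)) :=
    fun _ _ => hAU _ _
  have hB' : AllPos (B.submatrix ((T.sigmaEquiv l).trans f) ((T.sigmaEquiv l).trans f)) :=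
    fun _ _ => hB _ _
  have hBU' : OverField U (B.submatrix ((T.sigmaEquiv l).trans f) ((T.sigmaEquiv l).trans f)) :=
    fun _ _ => hBU _ _
  have start := ((linked_submatrix hA hAU _).reach hA' hAU').reachLim hA' hAU'.fieldType
  have h := ((iff.1 start).reach hB').linked hBU' k ((T.sigmaEquiv l).trans f)
  rwa [Matrix.reindex_apply, Matrix.submatrix_submatrix, Equiv.self_comp_symm,
    Matrix.submatrix_id_id] at h

lemma Relation.ReflTransGen.exists_seq {α : Type*} {r : α → α → Prop} {a b : α}
    (h : Relation.ReflTransGen r a b) (hb : r b b) :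
    ∃ (p : ℕ → α) (l : ℕ), p 0 = a ∧ p l = b ∧ ∀ i, r (p i) (p (i + 1)) := by
  induction h using Relation.ReflTransGen.head_induction_on with
  | refl => exact ⟨fun _ => b, 0, rfl, rfl, fun _ => hb⟩
  | @head a c hac _ ih =>
    obtain ⟨p, l, rfl, hl, hp⟩ := ih
    exact ⟨fun i => Nat.casesOn i a p, l + 1, rfl, hl, fun i => by
      cases i with
      | zero => exact hac
      | succ i => exact hp i⟩

lemma eq_of_isEmpty_fin {p q : (n : ℕ) × Matrix (Fin n) (Fin n) ℝ} (hp : IsEmpty (Fin p.1))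
    (hq : IsEmpty (Fin q.1)) : p = q := by
  obtain ⟨m, A⟩ := p
  obtain ⟨k, B⟩ := q
  obtain rfl : m = 0 := by_contra fun h => hp.elim ⟨0, Nat.pos_of_ne_zero h⟩
  obtain rfl : k = 0 := by_contra fun h => hq.elim ⟨0, Nat.pos_of_ne_zero h⟩
  rw [Subsingleton.elim A B]

lemma reflTransGen_posStep_of_seq {U : Subfield ℝ}
    {p : ℕ → (n : ℕ) × Matrix (Fin n) (Fin n) ℝ}
    (hp : ∀ i, ESSE {x : ℝ | 0 ≤ x} (p i) (p (i + 1))) {l : ℕ}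
    (h0U : entriesIn (U : Set ℝ) (p 0).2) (hlU : entriesIn (U : Set ℝ) (p l).2)
    (h0 : PosEntries (p 0).2) (hl : PosEntries (p l).2) :
    Relation.ReflTransGen (PosStep U) (p 0) (p l) := by
  choose R S hR hS hRS hSR using hp
  have comm : ∀ i, S i * R i = R (i + 1) * S (i + 1) := fun i => (hSR i).symm.trans (hRS _)
  have hA : AllPos (R 0 * S 0) := hRS 0 ▸ h0
  have hB : AllPos (R l * S l) := hRS l ▸ hl
  have all0 := trimmed_of_allPos comm hA
  have alll := trimmed_of_allPos comm hB
  rcases isEmpty_or_nonempty (Fin (p 0).1) with hE | hN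
  · have hE' : IsEmpty (Fin (p l).1) := ⟨fun x => let ⟨a, _⟩ := (alll x).1; hE.elim a⟩
    rw [eq_of_isEmpty_fin hE hE']
  · exact Ladder.reflTransGen_posStep (Ladder.trim hR hS comm hA) h0U hlU h0 hl
      (Equiv.subtypeUnivEquiv all0) (Equiv.subtypeUnivEquiv alll)
      ((Ladder.trim_hop hR hS comm hA 0).trans (by rw [hRS 0]; rfl))
      ((Ladder.trim_hop hR hS comm hA l).trans (by rw [hRS l]; rfl))

/-- If `U` is a subfield of `ℝ` and `A, B` are positive matrices over `U` which are SSE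
over `ℝ₊`, then `A` and `B` are SSE over `U₊` through positive matrices over `U`. -/
theorem field_theorem (U : Subfield ℝ)
    {m k : ℕ} (A : Matrix (Fin m) (Fin m) ℝ) (B : Matrix (Fin k) (Fin k) ℝ)
    (hAU : entriesIn (U : Set ℝ) A) (hBU : entriesIn (U : Set ℝ) B)
    (hA : PosEntries A) (hB : PosEntries B)
    (hsse : SSE {x : ℝ | 0 ≤ x} ⟨m, A⟩ ⟨k, B⟩) :
    Relation.ReflTransGen
      (fun p q => PosEntries p.2 ∧ PosEntries q.2 ∧
        entriesIn (U : Set ℝ) p.2 ∧ entriesIn (U : Set ℝ) q.2 ∧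
        ESSE {x : ℝ | x ∈ U ∧ 0 ≤ x} p q)
      ⟨m, A⟩ ⟨k, B⟩ := by
  have hrefl : ESSE {x : ℝ | 0 ≤ x} ⟨k, B⟩ ⟨k, B⟩ :=
    ⟨B, 1, fun i j => (hB i j).le, fun i j => by
      rw [Set.mem_ofPred_eq, Matrix.one_apply]
      split_ifs <;> norm_num, (Matrix.mul_one B).symm, (Matrix.one_mul B).symm⟩
  obtain ⟨p, l, h0, hl, hp⟩ := Relation.ReflTransGen.exists_seq hsse hrefl
  have := reflTransGen_posStep_of_seq (U := U) hp (l := l) (by rwa [h0]) (by rwa [hl])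
    (by rwa [h0]) (by rwa [hl])
  rwa [h0, hl] at this
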